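/- Let k ≥ 0, d ≥ 1 be integers, s = (k+1)/d, and fix σ > 0. There exist constants c, C > 0 depending only on k, d, σ such that for every N > k+1 with n = N^d ≥ 2 and every 0 < B_n ≤ √n, the minimax risk over the discrete Sobolev class satisfies c ( 1/n + min{ (B_n²/n)^{1/(2s+1)}, 1 } ) ≤ R( 𝒲_{n,d}^{k+1}(B_n) ) ≤ C ( 1/n + min{ (B_n²/n)^{1/(2s+1)}, 1 } ), and the upper bound is attained by a projection estimator θ̂ = V_Q V_Qᵀ y, where V_Q has columns forming an orthonormal set of eigenvectors of (D_{n,d}^{(k+1)})ᵀ D_{n,d}^{(k+1)} indexed by Q = {1,…,τ}^d for an integer τ with τ^d of order (k+2)^d + (B_n² n^{2s})^{1/(2s+1)}. In particular, under the canonical scaling B_n = n^{1/2−s}, R( 𝒲_{n,d}^{k+1}(B_n) ) is of order n^{−2s/(2s+1)}. -/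

import Mathlib

open scoped BigOperators ENNReal NNReal
open MeasureTheory ProbabilityTheory Matrix

noncomputable section

/-- Univariate forward difference matrix `D^{(1)}_M ∈ ℝ^{(M-1)×M}`, with entries
`(D^{(1)}_M)_{i,i} = -1`, `(D^{(1)}_M)_{i,i+1} = 1` and `0` otherwise. -/
def D1 (M : ℕ) : Matrix (Fin (M - 1)) (Fin M) ℝ :=
  Matrix.of fun i j => if (j : ℕ) = (i : ℕ) then -1 else if (j : ℕ) = (i : ℕ) + 1 then 1 else 0

/-- Univariate difference operator of order `m` on `N` points:
`D^{(0)}_N = I_N` and `D^{(m+1)}_N = D^{(1)}_{N-m} D^{(m)}_N`.  In particular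
`Dop N (k+1)` is the operator `D_N^{(k+1)} ∈ ℝ^{(N-k-1) × N}`. -/
def Dop (N : ℕ) : (m : ℕ) → Matrix (Fin (N - m)) (Fin N) ℝ
  | 0 => Matrix.of fun i j => if (i : ℕ) = (j : ℕ) then 1 else 0
  | m + 1 => D1 (N - m) * Dop N m

/-- Row index type of the order-`m` KTF penalty matrix: a coordinate direction `j`,
a row index of the univariate operator, and the values of the other `d-1` lattice
coordinates. -/
abbrev KtfIdx (N d m : ℕ) :=
  Σ j : Fin d, Fin (N - m) × ({l : Fin d // l ≠ j} → Fin N)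

/-- Order-`m` KTF penalty matrix on the lattice `{1,…,N}^d`: the vertical block
concatenation over coordinate directions `j` of `I_N ⊗ ⋯ ⊗ D^{(m)}_N ⊗ ⋯ ⊗ I_N`
(`D^{(m)}_N` in the `j`-th factor). -/
def ktfMat (N d m : ℕ) : Matrix (KtfIdx N d m) (Fin d → Fin N) ℝ :=
  Matrix.of fun p x =>
    Dop N m p.2.1 (x p.1) *
      ∏ l : {l : Fin d // l ≠ p.1}, (if p.2.2 l = x l.1 then (1:ℝ) else 0)

/-- Product Gaussian measure with coordinatewise means `θ0` and variance `σ^2`. -/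
def gaussSeq {ι : Type*} [Fintype ι] (θ0 : ι → ℝ) (σ : ℝ) : Measure (ι → ℝ) :=
  Measure.pi fun i => gaussianReal (θ0 i) (Real.toNNReal (σ ^ 2))

/-- Normalized expected squared error `(1/n) E‖θhat(y) - θ0‖₂²` of the estimator
`θhat` when `y` has independent `N(θ0 i, σ²)` coordinates (value in `ℝ≥0∞`). -/
def riskE {ι : Type*} [Fintype ι] (θhat : (ι → ℝ) → ι → ℝ) (θ0 : ι → ℝ) (σ : ℝ) : ℝ≥0∞ :=
  (Fintype.card ι : ℝ≥0∞)⁻¹ * ∫⁻ y, ENNReal.ofReal (∑ i, (θhat y i - θ0 i) ^ 2) ∂(gaussSeq θ0 σ)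

/-- Minimax risk over a parameter set `K`: infimum over measurable estimators of the
worst-case normalized expected squared error. -/
def minimaxRisk {ι : Type*} [Fintype ι] (K : Set (ι → ℝ)) (σ : ℝ) : ℝ≥0∞ :=
  ⨅ θhat : {f : (ι → ℝ) → ι → ℝ // Measurable f}, ⨆ θ0 ∈ K, riskE θhat.1 θ0 σ

/-- Minimax linear risk over a parameter set `K`: infimum over linear estimators
`y ↦ S y`. -/
def minimaxLinearRisk {ι : Type*} [Fintype ι] [DecidableEq ι] (K : Set (ι → ℝ)) (σ : ℝ) : ℝ≥0∞ :=
  ⨅ S : Matrix ι ι ℝ, ⨆ θ0 ∈ K, riskE (fun y => S.mulVec y) θ0 σ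

/-- The discrete Sobolev class `𝒲_{n,d}^{k+1}(B) = {θ : ‖D_{n,d}^{(k+1)} θ‖₂ ≤ B}`. -/
def sobolevClass (N d k : ℕ) (B : ℝ) : Set ((Fin d → Fin N) → ℝ) :=
  {θ | Real.sqrt (∑ p, ((ktfMat N d (k + 1)).mulVec θ p) ^ 2) ≤ B}

/-- The Sobolev minimax rate `1/n + min{(B²/n)^{1/(2s+1)}, 1}` with `s = (k+1)/d`. -/
def sobolevRate (k d N : ℕ) (B : ℝ) : ℝ :=
  1 / ((N ^ d : ℕ) : ℝ) +
    min ((B ^ 2 / ((N ^ d : ℕ) : ℝ)) ^ ((1 : ℝ) / (2 * (((k : ℝ) + 1) / d) + 1))) 1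

instance {ι : Type*} [Fintype ι] (θ : ι → ℝ) (σ : ℝ) : IsProbabilityMeasure (gaussSeq θ σ) := by
  unfold gaussSeq; infer_instance

lemma lintegral_sq_linear_gaussSeq {ι : Type*} [Fintype ι] (θ a : ι → ℝ) (σ : ℝ) :
    ∫⁻ y, ENNReal.ofReal ((∑ x, a x * (y x - θ x)) ^ 2) ∂(gaussSeq θ σ) =
      ENNReal.ofReal (σ ^ 2 * ∑ x, a x ^ 2) := by
  have hL : ∀ x, MemLp (fun t : ℝ => a x * (t - θ x)) 2
      (gaussianReal (θ x) (Real.toNNReal (σ ^ 2))) := fun x =>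
    ((memLp_id_gaussianReal 2).sub (memLp_const (θ x))).const_mul (a x)
  have hint : ∀ x, ∫ t : ℝ, a x * (t - θ x) ∂(gaussianReal (θ x) (Real.toNNReal (σ ^ 2))) = 0 := by
    intro x
    rw [integral_const_mul, integral_sub, integral_id_gaussianReal]
    · simp
    · exact (memLp_id_gaussianReal 1).integrable le_rfl
    · exact integrable_const _
  have hLp : ∀ x, MemLp (fun y : ι → ℝ => a x * (y x - θ x)) 2 (gaussSeq θ σ) := fun x =>
    (hL x).comp_measurePreserving (measurePreserving_eval _ x)
  have hS : MemLp (fun y : ι → ℝ => ∑ x, a x * (y x - θ x)) 2 (gaussSeq θ σ) :=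
    memLp_finsetSum _ fun x _ => hLp x
  have hmean : ∫ y, (∑ x, a x * (y x - θ x)) ∂(gaussSeq θ σ) = 0 := by
    rw [integral_finsetSum _ fun x _ => (hLp x).integrable (by norm_num)]
    refine Finset.sum_eq_zero fun x _ => ?_
    rw [← hint x]
    exact integral_comp_eval (μ := fun i => gaussianReal (θ i) (Real.toNNReal (σ ^ 2)))
      (f := fun t : ℝ => a x * (t - θ x)) (hL x).1
  rw [← ofReal_integral_eq_lintegral_ofReal hS.integrable_sq
    (Filter.Eventually.of_forall fun _ => sq_nonneg _)]
  congr 1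
  have hv := variance_sum_pi (μ := fun i => gaussianReal (θ i) (Real.toNNReal (σ ^ 2)))
    (X := fun x (t : ℝ) => a x * (t - θ x)) hL
  have e : (∑ i, fun ω : ι → ℝ => a i * (ω i - θ i)) =
      fun y : ι → ℝ => ∑ x, a x * (y x - θ x) := by
    ext y; simp
  rw [e] at hv
  change Var[_; gaussSeq θ σ] = _ at hv
  rw [variance_eq_integral hS.1.aemeasurable, hmean] at hv
  simp only [sub_zero] at hv
  rw [hv, Finset.mul_sum]
  refine Finset.sum_congr rfl fun x _ => ?_
  rw [variance_const_mul, variance_sub_const (by fun_prop)]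
  rw [show (fun t : ℝ => t) = id from rfl, variance_id_gaussianReal,
    Real.coe_toNNReal _ (sq_nonneg σ)]
  ring

lemma gaussianReal_add_eq_withDensity (μ h : ℝ) {v : ℝ≥0} (hv : v ≠ 0) :
    gaussianReal (μ + h) v = (gaussianReal μ v).withDensity
      (fun y => ENNReal.ofReal (Real.exp (h * (y - μ) / v - h ^ 2 / (2 * v)))) := by
  have hv' : (v : ℝ) ≠ 0 := by exact_mod_cast hv
  rw [gaussianReal_of_var_ne_zero _ hv, gaussianReal_of_var_ne_zero _ hv,
    ← withDensity_mul _ (measurable_gaussianPDF μ v) (by fun_prop)]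
  congr 1
  ext y
  simp only [gaussianPDF, gaussianPDFReal, Pi.mul_apply]
  rw [← ENNReal.ofReal_mul (by positivity), mul_assoc (√_)⁻¹, ← Real.exp_add]
  congr 3
  field_simp
  ring

lemma pi_withDensity_prod {ι : Type*} [Fintype ι] (μ : ι → Measure ℝ)
    [∀ i, IsProbabilityMeasure (μ i)] (f : ι → ℝ → ℝ≥0∞) (hf : ∀ i, Measurable (f i))
    [∀ i, SigmaFinite ((μ i).withDensity (f i))] :
    Measure.pi (fun i => (μ i).withDensity (f i)) =
      (Measure.pi μ).withDensity (fun y => ∏ i, f i (y i)) := by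
  refine Measure.pi_eq fun s hs => ?_
  rw [withDensity_apply _ (MeasurableSet.univ_pi hs),
    ← lintegral_indicator (MeasurableSet.univ_pi hs)]
  have e : (Set.univ.pi s).indicator (fun y : ι → ℝ => ∏ i, f i (y i)) =
      fun y => ∏ i, (s i).indicator (f i) (y i) := by
    ext y
    by_cases hy : y ∈ Set.univ.pi s
    · rw [Set.indicator_of_mem hy]
      exact Finset.prod_congr rfl fun i _ => (Set.indicator_of_mem (hy i trivial) _).symm
    · rw [Set.indicator_of_notMem hy]
      simp only [Set.mem_univ_pi, not_forall] at hy
      obtain ⟨i, hi⟩ := hy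
      exact (Finset.prod_eq_zero (Finset.mem_univ i) (Set.indicator_of_notMem hi _)).symm
  have hm : ∀ i, Measurable ((s i).indicator (f i)) := fun i => (hf i).indicator (hs i)
  rw [e, lintegral_prod_eq_prod_lintegral_of_indepFun Finset.univ
    (fun i (y : ι → ℝ) => (s i).indicator (f i) (y i))
    (iIndepFun_pi fun i => (hm i).aemeasurable) (fun i => (hm i).comp (measurable_pi_apply i))]
  refine Finset.prod_congr rfl fun i _ => ?_
  rw [withDensity_apply _ (hs i), ← lintegral_indicator (hs i)]
  exact (measurePreserving_eval μ i).lintegral_comp (hm i)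

lemma gaussSeq_add_eq_withDensity {ι : Type*} [Fintype ι] (θ h : ι → ℝ) {σ : ℝ} (hσ : 0 < σ) :
    gaussSeq (θ + h) σ = (gaussSeq θ σ).withDensity (fun y => ENNReal.ofReal
      (Real.exp ((∑ i, h i * (y i - θ i)) / σ ^ 2 - (∑ i, h i ^ 2) / (2 * σ ^ 2)))) := by
  have hv : Real.toNNReal (σ ^ 2) ≠ 0 := by
    simpa using hσ.ne'
  have hd : ∀ i, gaussianReal ((θ + h) i) (Real.toNNReal (σ ^ 2)) =
      (gaussianReal (θ i) (Real.toNNReal (σ ^ 2))).withDensity (fun y => ENNReal.ofReal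
        (Real.exp (h i * (y - θ i) / Real.toNNReal (σ ^ 2)
          - h i ^ 2 / (2 * Real.toNNReal (σ ^ 2))))) := fun i =>
    gaussianReal_add_eq_withDensity (θ i) (h i) hv
  have : ∀ i, SigmaFinite ((gaussianReal (θ i) (Real.toNNReal (σ ^ 2))).withDensity
      (fun y => ENNReal.ofReal (Real.exp (h i * (y - θ i) / Real.toNNReal (σ ^ 2)
          - h i ^ 2 / (2 * Real.toNNReal (σ ^ 2)))))) := fun i => by
    rw [← hd i]; infer_instance
  unfold gaussSeq
  simp only [hd]
  rw [pi_withDensity_prod _ _ (fun i => by fun_prop)]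
  congr 1
  ext y
  rw [← ENNReal.ofReal_prod_of_nonneg (fun i _ => (Real.exp_pos _).le), ← Real.exp_sum,
    Real.coe_toNNReal _ (sq_nonneg σ), Finset.sum_sub_distrib, Finset.sum_div, Finset.sum_div]

lemma two_point_gaussSeq {ι : Type*} [Fintype ι] (θ h : ι → ℝ) {σ : ℝ} (hσ : 0 < σ)
    (hh : ∑ i, h i ^ 2 ≤ σ ^ 2) (A : (ι → ℝ) → ℝ) (hA : Measurable A) (a b : ℝ) :
    ENNReal.ofReal ((a - b) ^ 2 * Real.exp (-1) / 2) ≤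
      (∫⁻ y, ENNReal.ofReal ((A y - a) ^ 2) ∂(gaussSeq (θ + h) σ)) +
        ∫⁻ y, ENNReal.ofReal ((A y - b) ^ 2) ∂(gaussSeq (θ + -h) σ) := by
  set p : (ι → ℝ) → (ι → ℝ) → ℝ := fun h y =>
    Real.exp ((∑ i, h i * (y i - θ i)) / σ ^ 2 - (∑ i, h i ^ 2) / (2 * σ ^ 2)) with hp
  have hpm : ∀ h, Measurable fun y => ENNReal.ofReal (p h y) := fun h => by
    simp only [hp]; fun_prop
  have hpp : ∀ h y, 0 < p h y := fun h y => Real.exp_pos _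
  have hmass : ∀ h, ∫⁻ y, ENNReal.ofReal (p h y) ∂(gaussSeq θ σ) = 1 := fun h => by
    rw [← setLIntegral_univ, ← withDensity_apply _ MeasurableSet.univ,
      ← gaussSeq_add_eq_withDensity θ h hσ, measure_univ]
  have hpq : ∀ y, Real.exp (-1) ≤ p h y * p (-h) y := by
    intro y
    simp only [hp]
    rw [← Real.exp_add, Real.exp_le_exp]
    have : (∑ i, h i ^ 2) / σ ^ 2 ≤ 1 := by rw [div_le_one (by positivity)]; exact hh
    simp only [Pi.neg_apply, neg_mul, Finset.sum_neg_distrib, even_two, Even.neg_pow, neg_div]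
    have e : (∑ i, h i ^ 2) / (2 * σ ^ 2) = (∑ i, h i ^ 2) / σ ^ 2 / 2 := by
      field_simp
    rw [e]
    linarith
  set D := (a - b) ^ 2 * Real.exp (-1) with hD
  have hD0 : 0 ≤ D := by positivity
  have key : ∀ y, D ≤ p h y * (A y - a) ^ 2 + p (-h) y * (A y - b) ^ 2
      + (D / 4 * p h y + D / 4 * p (-h) y) := by
    intro y
    have hP := hpp h y
    have hQ := hpp (-h) y
    have h1 := hpq y
    set P := p h y
    set Q := p (-h) y
    have h2 : D ≤ P * Q * (a - b) ^ 2 := by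
      rw [hD, mul_comm]; exact mul_le_mul_of_nonneg_right h1 (sq_nonneg _)
    have h3 : P * Q * (a - b) ^ 2 ≤ (P + Q) * (P * (A y - a) ^ 2 + Q * (A y - b) ^ 2) := by
      nlinarith [sq_nonneg (P * (A y - a) + Q * (A y - b))]
    refine le_of_mul_le_mul_left ?_ (add_pos hP hQ)
    nlinarith [mul_nonneg hD0 (sq_nonneg (P + Q - 2))]
  rw [gaussSeq_add_eq_withDensity θ h hσ, gaussSeq_add_eq_withDensity θ (-h) hσ,
    lintegral_withDensity_eq_lintegral_mul _ (hpm h) (by fun_prop),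
    lintegral_withDensity_eq_lintegral_mul _ (hpm (-h)) (by fun_prop)]
  simp only [Pi.mul_apply]
  have hI : ENNReal.ofReal D ≤
      ((∫⁻ y, ENNReal.ofReal (p h y) * ENNReal.ofReal ((A y - a) ^ 2) ∂(gaussSeq θ σ)) +
        ∫⁻ y, ENNReal.ofReal (p (-h) y) * ENNReal.ofReal ((A y - b) ^ 2) ∂(gaussSeq θ σ))
        + ENNReal.ofReal (D / 2) := by
    have e1 : ENNReal.ofReal (D / 2) =
        (∫⁻ y, ENNReal.ofReal (D / 4) * ENNReal.ofReal (p h y) ∂(gaussSeq θ σ)) +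
        ∫⁻ y, ENNReal.ofReal (D / 4) * ENNReal.ofReal (p (-h) y) ∂(gaussSeq θ σ) := by
      rw [lintegral_const_mul _ (hpm h), lintegral_const_mul _ (hpm _), hmass, hmass, mul_one,
        ← ENNReal.ofReal_add (by positivity) (by positivity)]
      congr 1; ring
    have hm1 : ∀ h c, Measurable fun y => ENNReal.ofReal (p h y) * ENNReal.ofReal ((A y - c) ^ 2) :=
      fun h c => (hpm h).mul (by fun_prop)
    rw [e1, ← lintegral_add_left (hm1 _ _), ← lintegral_add_left ((hpm h).const_mul _),
      ← lintegral_add_left (by fun_prop)]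
    calc ENNReal.ofReal D = ∫⁻ _, ENNReal.ofReal D ∂(gaussSeq θ σ) := by simp
      _ ≤ _ := by
        refine lintegral_mono fun y => ?_
        have := hpp h y
        have := hpp (-h) y
        simp only
        rw [← ENNReal.ofReal_mul (by positivity), ← ENNReal.ofReal_mul (by positivity),
          ← ENNReal.ofReal_mul (by positivity), ← ENNReal.ofReal_mul (by positivity),
          ← ENNReal.ofReal_add (by positivity) (by positivity),
          ← ENNReal.ofReal_add (by positivity) (by positivity),
          ← ENNReal.ofReal_add (by positivity) (by positivity)]
        exact ENNReal.ofReal_le_ofReal (key y)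
  rw [← add_halves D, ENNReal.ofReal_add (by positivity) (by positivity), add_halves] at hI
  exact (ENNReal.add_le_add_iff_right ENNReal.ofReal_ne_top).1 hI

/-- The vertex of a hypercube in `ℝ^ι`: the vector `Φ` with the sign `ω s` on the block `s`. -/
def signedVec {ι S : Type*} (blk : ι → S) (Φ : ι → ℝ) (ω : S → Bool) (x : ι) : ℝ :=
  (if ω (blk x) then 1 else -1) * Φ x

/-- Average over the two vertices of a hypercube edge, at a single coordinate. -/
lemma signedVec_edge {ι S : Type*} [Fintype ι] [DecidableEq S] (blk : ι → S) (Φ : ι → ℝ)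
    {σ : ℝ} (hσ : 0 < σ) (hΦ : ∀ s, ∑ x with blk x = s, Φ x ^ 2 ≤ σ ^ 2) (ω : S → Bool) (x : ι)
    (A : (ι → ℝ) → ℝ) (hA : Measurable A) :
    ENNReal.ofReal (2 * Real.exp (-1) * Φ x ^ 2) ≤
      (∫⁻ y, ENNReal.ofReal ((A y - signedVec blk Φ ω x) ^ 2) ∂(gaussSeq (signedVec blk Φ ω) σ)) +
      ∫⁻ y, ENNReal.ofReal
        ((A y - signedVec blk Φ (Function.update ω (blk x) (!ω (blk x))) x) ^ 2)
        ∂(gaussSeq (signedVec blk Φ (Function.update ω (blk x) (!ω (blk x)))) σ) := by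
  set ω' := Function.update ω (blk x) (!ω (blk x)) with hω'
  set θ : ι → ℝ := fun z => if blk z = blk x then 0 else signedVec blk Φ ω z with hθ
  set h : ι → ℝ := fun z => if blk z = blk x then signedVec blk Φ ω z else 0 with hh
  have e1 : signedVec blk Φ ω = θ + h := by
    ext z
    by_cases hz : blk z = blk x <;> simp [hθ, hh, hz]
  have e2 : signedVec blk Φ ω' = θ + -h := by
    ext z
    by_cases hz : blk z = blk x
    · cases hb : ω (blk x) <;> simp [hθ, hh, hz, signedVec, hω', hb]
    · simp [hθ, hh, hz, signedVec, hω']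
  have h3 : ∑ z, h z ^ 2 ≤ σ ^ 2 := by
    refine le_trans (le_of_eq ?_) (hΦ (blk x))
    rw [Finset.sum_filter]
    refine Finset.sum_congr rfl fun z _ => ?_
    by_cases hz : blk z = blk x
    · cases hb : ω (blk x) <;> simp [hh, hz, signedVec, hb]
    · simp [hh, hz]
  have h4 : (signedVec blk Φ ω x - signedVec blk Φ ω' x) ^ 2 = 4 * Φ x ^ 2 := by
    cases hb : ω (blk x) <;> simp [signedVec, hω', hb] <;> ring
  have := two_point_gaussSeq θ h hσ h3 A hA (signedVec blk Φ ω x) (signedVec blk Φ ω' x)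
  rw [h4, ← e1, ← e2] at this
  refine le_trans (le_of_eq ?_) this
  congr 1; ring

/-- Assouad's lemma for a hypercube with blockwise signs. -/
lemma assouad_minimaxRisk {ι S : Type*} [Fintype ι] [Fintype S] [DecidableEq S]
    (K : Set (ι → ℝ)) (blk : ι → S) (Φ : ι → ℝ) {σ : ℝ} (hσ : 0 < σ)
    (hΦ : ∀ s, ∑ x with blk x = s, Φ x ^ 2 ≤ σ ^ 2) (hK : ∀ ω, signedVec blk Φ ω ∈ K) :
    (Fintype.card ι : ℝ≥0∞)⁻¹ * ENNReal.ofReal (Real.exp (-1) * ∑ x, Φ x ^ 2) ≤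
      minimaxRisk K σ := by
  refine le_iInf fun f => ?_
  have hfx : ∀ x, Measurable fun y => f.1 y x := fun x => (measurable_pi_apply x).comp f.2
  set E : (S → Bool) → ι → ℝ≥0∞ := fun ω x =>
    ∫⁻ y, ENNReal.ofReal ((f.1 y x - signedVec blk Φ ω x) ^ 2) ∂(gaussSeq (signedVec blk Φ ω) σ)
    with hE
  have hrisk : ∀ ω, riskE f.1 (signedVec blk Φ ω) σ =
      (Fintype.card ι : ℝ≥0∞)⁻¹ * ∑ x, E ω x := by
    intro ω
    have hm : ∀ x, Measurable fun y => ENNReal.ofReal ((f.1 y x - signedVec blk Φ ω x) ^ 2) :=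
      fun x => by have := hfx x; fun_prop
    rw [riskE, hE]
    simp only
    rw [← lintegral_finsetSum _ fun x _ => hm x]
    congr 1
    refine lintegral_congr fun y => ?_
    rw [ENNReal.ofReal_sum_of_nonneg fun x _ => sq_nonneg _]
  have hx : ∀ x, ∑ _ω : S → Bool, ENNReal.ofReal (Real.exp (-1) * Φ x ^ 2) ≤ ∑ ω, E ω x := by
    intro x
    have hflip : ∑ ω : S → Bool, E (Function.update ω (blk x) (!ω (blk x))) x = ∑ ω, E ω x := by
      refine Function.Bijective.sum_comp (Function.Involutive.bijective fun ω => ?_)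
        (fun ω => E ω x)
      simp
    have h2 : ∑ _ω : S → Bool, ENNReal.ofReal (2 * Real.exp (-1) * Φ x ^ 2) ≤
        ∑ ω, E ω x + ∑ ω, E ω x := by
      conv_rhs => rw [← hflip]
      nth_rewrite 1 [hflip]
      rw [← Finset.sum_add_distrib]
      exact Finset.sum_le_sum fun ω _ => signedVec_edge blk Φ hσ hΦ ω x _ (hfx x)
    rw [← two_mul] at h2
    have h3 : ∑ _ω : S → Bool, ENNReal.ofReal (2 * Real.exp (-1) * Φ x ^ 2) =
        2 * ∑ _ω : S → Bool, ENNReal.ofReal (Real.exp (-1) * Φ x ^ 2) := by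
      rw [Finset.mul_sum]
      refine Finset.sum_congr rfl fun _ _ => ?_
      rw [mul_assoc, ENNReal.ofReal_mul (by norm_num)]
      simp
    rw [h3] at h2
    exact (ENNReal.mul_le_mul_iff_right (by norm_num) (by norm_num)).1 h2
  have htot : ∑ _ω : S → Bool, ENNReal.ofReal (Real.exp (-1) * ∑ x, Φ x ^ 2) ≤
      ∑ ω, ∑ x, E ω x := by
    rw [Finset.sum_comm]
    refine le_trans (le_of_eq ?_) (Finset.sum_le_sum fun x _ => hx x)
    rw [Finset.sum_comm]
    refine Finset.sum_congr rfl fun _ _ => ?_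
    rw [Finset.mul_sum, ENNReal.ofReal_sum_of_nonneg fun x _ => by positivity]
  obtain ⟨ω, -, hmax⟩ := Finset.exists_max_image Finset.univ (fun ω => ∑ x, E ω x)
    (Finset.univ_nonempty (α := S → Bool))
  have hω := htot.trans (Finset.sum_le_card_nsmul _ _ _ hmax)
  rw [Finset.sum_const, nsmul_eq_mul, nsmul_eq_mul] at hω
  replace hω := (ENNReal.mul_le_mul_iff_right (by simp) (by simp)).1 hω
  calc _ ≤ (Fintype.card ι : ℝ≥0∞)⁻¹ * ∑ x, E ω x := by gcongr
    _ = riskE f.1 (signedVec blk Φ ω) σ := (hrisk ω).symm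
    _ ≤ _ := le_iSup₂ (f := fun θ0 (_ : θ0 ∈ K) => riskE f.1 θ0 σ) _ (hK ω)

lemma sum_sq_lincomb_of_gram {α ι : Type*} [Fintype α] [DecidableEq α] [Fintype ι]
    (w : α → ι → ℝ) (g : α → ℝ) (hw : ∀ a b, ∑ x, w a x * w b x = if a = b then g b else 0)
    (c : α → ℝ) : ∑ x, (∑ a, c a * w a x) ^ 2 = ∑ a, g a * c a ^ 2 := by
  calc ∑ x, (∑ a, c a * w a x) ^ 2
      = ∑ x, ∑ a, ∑ b, c a * c b * (w a x * w b x) := by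
        refine Finset.sum_congr rfl fun x _ => ?_
        rw [sq, Finset.sum_mul_sum]
        refine Finset.sum_congr rfl fun a _ => Finset.sum_congr rfl fun b _ => by ring
    _ = ∑ a, ∑ b, c a * c b * ∑ x, w a x * w b x := by
        rw [Finset.sum_comm]
        refine Finset.sum_congr rfl fun a _ => ?_
        rw [Finset.sum_comm]
        simp only [Finset.mul_sum]
    _ = ∑ a, g a * c a ^ 2 := by
        refine Finset.sum_congr rfl fun a _ => ?_
        simp only [hw, mul_ite, mul_zero, Finset.sum_ite_eq, Finset.mem_univ, if_true]
        ring

lemma sum_sq_lincomb_orthonormal {α ι : Type*} [Fintype α] [DecidableEq α] [Fintype ι]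
    (u : α → ι → ℝ) (hu : ∀ a b, ∑ x, u a x * u b x = if a = b then (1 : ℝ) else 0)
    (c : α → ℝ) : ∑ x, (∑ a, c a * u a x) ^ 2 = ∑ a, c a ^ 2 := by
  simpa using sum_sq_lincomb_of_gram u (fun _ => 1) hu c

lemma sum_sq_mulVec_lincomb_eigen {α ι κ : Type*} [Fintype α] [DecidableEq α] [Fintype ι]
    [Fintype κ] (M : Matrix κ ι ℝ) (u : α → ι → ℝ)
    (hu : ∀ a b, ∑ x, u a x * u b x = if a = b then (1 : ℝ) else 0)
    (g : α → ℝ) (hg : ∀ a, (Mᵀ * M).mulVec (u a) = g a • u a) (c : α → ℝ) :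
    ∑ p, (M.mulVec (fun x => ∑ a, c a * u a x) p) ^ 2 = ∑ a, g a * c a ^ 2 := by
  have hlin : ∀ p, M.mulVec (fun x => ∑ a, c a * u a x) p = ∑ a, c a * M.mulVec (u a) p := by
    intro p
    simp only [mulVec, dotProduct, Finset.mul_sum]
    rw [Finset.sum_comm]
    refine Finset.sum_congr rfl fun a _ => Finset.sum_congr rfl fun x _ => by ring
  simp only [hlin]
  refine sum_sq_lincomb_of_gram (fun a => M.mulVec (u a)) g (fun a b => ?_) c
  change M.mulVec (u a) ⬝ᵥ M.mulVec (u b) = _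
  rw [dotProduct_mulVec, ← mulVec_transpose, mulVec_mulVec, hg, smul_dotProduct]
  change g a * ∑ x, u a x * u b x = _
  rw [hu]
  by_cases h : a = b
  · simp [h]
  · simp [h]

lemma D1_mulVec (M : ℕ) (f : ℕ → ℝ) (i : Fin (M - 1)) :
    (D1 M).mulVec (fun j => f j) i = f (i + 1) - f i := by
  have hi : (i : ℕ) + 1 < M := by omega
  have hj : ∀ j : Fin M, D1 M i j * f j =
      (if j = ⟨i + 1, hi⟩ then f j else 0) - (if j = ⟨i, by omega⟩ then f j else 0) := by
    intro j
    simp only [D1, of_apply, Fin.ext_iff]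
    by_cases h1 : (j : ℕ) = i
    · simp [h1]
    · by_cases h2 : (j : ℕ) = i + 1 <;> simp [h1, h2]
  simp only [mulVec, dotProduct, hj, Finset.sum_sub_distrib, Finset.sum_ite_eq', Finset.mem_univ,
    if_true]

lemma Dop_mulVec (N m : ℕ) (f : ℕ → ℝ) (i : Fin (N - m)) :
    (Dop N m).mulVec (fun j => f j) i = (fwdDiff 1)^[m] f i := by
  induction m with
  | zero =>
    have : ∀ j : Fin N, Dop N 0 i j * f j = if j = i then f j else 0 := by
      intro j
      simp only [Dop, of_apply, Fin.ext_iff, ite_mul, one_mul, zero_mul, eq_comm]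
    simp only [mulVec, dotProduct, this]
    exact (Finset.sum_ite_eq' _ _ _).trans (by simp)
  | succ m ih =>
    have : (Dop N m).mulVec (fun j => f j) =
        fun i : Fin (N - m) => (fwdDiff 1)^[m] f (i : ℕ) := funext ih
    rw [Dop, ← mulVec_mulVec, this, D1_mulVec, Function.iterate_succ_apply', fwdDiff]

/-- Discrete Poincaré inequality for sequences vanishing at the multiples of `L`. -/
lemma sum_sq_le_sum_sq_fwdDiff (x : ℕ → ℝ) (L M : ℕ) (hL : 0 < L)
    (hx : ∀ q, L * q < M → x (L * q) = 0) :
    ∑ i ∈ Finset.range M, x i ^ 2 ≤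
      (L : ℝ) ^ 2 * ∑ i ∈ Finset.range (M - 1), (fwdDiff 1 x i) ^ 2 := by
  have h1 : ∀ i ∈ Finset.range M, x i ^ 2 ≤
      L * ∑ t ∈ Finset.range (M - 1), if L * (i / L) ≤ t ∧ t < i then (fwdDiff 1 x t) ^ 2 else 0 := by
    intro i hi
    have hi' := Finset.mem_range.1 hi
    have hle : L * (i / L) ≤ i := Nat.mul_div_le i L
    have hmod : L * (i / L) + i % L = i := Nat.div_add_mod i L
    have hlt : i % L < L := Nat.mod_lt i hL
    have htel : x i = ∑ t ∈ Finset.Ico (L * (i / L)) i, fwdDiff 1 x t := by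
      have h := Finset.sum_Ico_sub x hle
      rw [hx (i / L) (by omega), sub_zero] at h
      exact h.symm
    have hset : (Finset.range (M - 1)).filter (fun t => L * (i / L) ≤ t ∧ t < i) =
        Finset.Ico (L * (i / L)) i := by
      ext t
      simp only [Finset.mem_filter, Finset.mem_range, Finset.mem_Ico]
      omega
    rw [← Finset.sum_filter, hset, htel]
    refine (sq_sum_le_card_mul_sum_sq).trans ?_
    refine mul_le_mul_of_nonneg_right ?_ (Finset.sum_nonneg fun _ _ => sq_nonneg _)
    rw [Nat.card_Ico]
    exact_mod_cast (by omega : i - L * (i / L) ≤ L)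
  refine (Finset.sum_le_sum h1).trans ?_
  rw [← Finset.mul_sum, Finset.sum_comm, sq, mul_assoc]
  refine mul_le_mul_of_nonneg_left ?_ (Nat.cast_nonneg L)
  rw [Finset.mul_sum]
  refine Finset.sum_le_sum fun t _ => ?_
  rw [← Finset.sum_filter, Finset.sum_const, nsmul_eq_mul]
  refine mul_le_mul_of_nonneg_right ?_ (sq_nonneg _)
  have hsub : (Finset.range M).filter (fun i => L * (i / L) ≤ t ∧ t < i) ⊆
      Finset.Ico (t + 1) (t + 1 + L) := by
    intro i hi
    simp only [Finset.mem_filter, Finset.mem_range, Finset.mem_Ico] at hi ⊢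
    have hmod : L * (i / L) + i % L = i := Nat.div_add_mod i L
    have hlt : i % L < L := Nat.mod_lt i hL
    omega
  have := Finset.card_le_card hsub
  rw [Nat.card_Ico] at this
  exact_mod_cast (by omega)

lemma sum_sq_le_sum_sq_fwdDiff_iter (x : ℕ → ℝ) (L N m : ℕ) (hL : 0 < L)
    (hx : ∀ j < m, ∀ q, L * q < N → (fwdDiff 1)^[j] x (L * q) = 0) :
    ∑ i ∈ Finset.range N, x i ^ 2 ≤
      (L : ℝ) ^ (2 * m) * ∑ i ∈ Finset.range (N - m), ((fwdDiff 1)^[m] x i) ^ 2 := by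
  induction m with
  | zero => simp
  | succ m ih =>
    refine (ih fun j hj => hx j (by omega)).trans ?_
    have h := sum_sq_le_sum_sq_fwdDiff ((fwdDiff 1)^[m] x) L (N - m) hL
      fun q hq => hx m (by omega) q (by omega)
    rw [← Function.iterate_succ_apply' (fwdDiff 1) m x] at h
    calc _ ≤ (L : ℝ) ^ (2 * m) * _ := mul_le_mul_of_nonneg_left h (by positivity)
      _ = _ := by rw [← mul_assoc, ← pow_add]; rfl

lemma one_le_pow_mul_eigenvalue (N m L r : ℕ) (hL : 0 < L) (hr : N ≤ L * r)
    (u : Fin N → Fin N → ℝ) (ρ : Fin N → ℝ) (hρ : Monotone ρ)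
    (hu : ∀ a b, ∑ x, u a x * u b x = if a = b then (1 : ℝ) else 0)
    (heig : ∀ i, ((Dop N m)ᵀ * Dop N m).mulVec (u i) = ρ i • u i)
    (τ : Fin N) (hτ : m * r ≤ τ) : 1 ≤ (L : ℝ) ^ (2 * m) * ρ τ := by
  set e : Fin N → ℕ → ℝ := fun a i => if h : i < N then u a ⟨i, h⟩ else 0 with he
  set emb : Fin ((τ : ℕ) + 1) → Fin N := fun a => ⟨a, by omega⟩ with hemb
  have hinj : Function.Injective emb := fun a b h => by
    simpa [hemb, Fin.ext_iff] using h
  set A : Matrix (Fin m × Fin r) (Fin ((τ : ℕ) + 1)) ℝ :=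
    Matrix.of fun p a => (fwdDiff 1)^[(p.1 : ℕ)] (e (emb a)) (L * p.2) with hA
  have hker : LinearMap.ker A.mulVecLin ≠ ⊥ := by
    refine LinearMap.ker_ne_bot_of_finrank_lt ?_
    simp
    omega
  obtain ⟨c, hc, hc0⟩ := (Submodule.ne_bot_iff _).1 hker
  set f : ℕ → ℝ := ∑ a, c a • e (emb a) with hf
  have hfN : (fun x : Fin N => f x) = fun x => ∑ a, c a * u (emb a) x := by
    ext x
    simp [hf, he]
  have hfj : ∀ j i, (fwdDiff 1)^[j] f i = ∑ a, c a * (fwdDiff 1)^[j] (e (emb a)) i := by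
    intro j i
    rw [hf, fwdDiff_iter_finsetSum]
    simp [fwdDiff_iter_const_smul]
  have hvan : ∀ j < m, ∀ q, L * q < N → (fwdDiff 1)^[j] f (L * q) = 0 := by
    intro j hj q hq
    have hqr : q < r := by
      by_contra hcon
      have := Nat.mul_le_mul_left L (not_lt.1 hcon)
      omega
    have h0 := congrFun (LinearMap.mem_ker.1 hc) (⟨j, hj⟩, ⟨q, hqr⟩)
    simp only [mulVecLin_apply, mulVec, dotProduct, hA, of_apply, Pi.zero_apply] at h0
    rw [hfj, ← h0]
    exact Finset.sum_congr rfl fun a _ => mul_comm _ _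
  have hmain := sum_sq_le_sum_sq_fwdDiff_iter f L N m hL hvan
  rw [Finset.sum_range, Finset.sum_range] at hmain
  have huo : ∀ a b : Fin ((τ : ℕ) + 1), ∑ x, u (emb a) x * u (emb b) x =
      if a = b then (1 : ℝ) else 0 := by
    intro a b
    rw [hu]
    simp [hinj.eq_iff]
  have hL2 : ∑ x : Fin N, f x ^ 2 = ∑ a, c a ^ 2 := by
    rw [← sum_sq_lincomb_orthonormal (fun a => u (emb a)) huo c]
    exact Finset.sum_congr rfl fun x _ => by rw [← congrFun hfN x]
  have hDf : ∑ i : Fin (N - m), ((fwdDiff 1)^[m] f i) ^ 2 = ∑ a, ρ (emb a) * c a ^ 2 := by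
    rw [← sum_sq_mulVec_lincomb_eigen (Dop N m) (fun a => u (emb a)) huo (fun a => ρ (emb a))
      (fun a => heig _) c, ← hfN]
    exact Finset.sum_congr rfl fun i _ => by rw [Dop_mulVec]
  rw [hL2, hDf] at hmain
  have hpos : 0 < ∑ a, c a ^ 2 := by
    obtain ⟨a, ha⟩ := Function.ne_iff.1 hc0
    exact Finset.sum_pos' (fun _ _ => sq_nonneg _) ⟨a, Finset.mem_univ _, by
      have : c a ≠ 0 := ha
      positivity⟩
  have hle : ∑ a, ρ (emb a) * c a ^ 2 ≤ ρ τ * ∑ a, c a ^ 2 := by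
    rw [Finset.mul_sum]
    refine Finset.sum_le_sum fun a _ => mul_le_mul_of_nonneg_right (hρ ?_) (sq_nonneg _)
    have : (a : ℕ) ≤ τ := by omega
    exact this
  have hfin : 1 * ∑ a, c a ^ 2 ≤ ((L : ℝ) ^ (2 * m) * ρ τ) * ∑ a, c a ^ 2 := by
    rw [one_mul, mul_assoc]
    exact hmain.trans (mul_le_mul_of_nonneg_left hle (by positivity))
  exact le_of_mul_le_mul_right hfin hpos

lemma prod_ite_eq_ite_eq {α β : Type*} [Fintype α] [DecidableEq β] (f g : α → β) :
    (∏ l, (if f l = g l then (1 : ℝ) else 0)) = if f = g then 1 else 0 := by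
  rw [Fintype.prod_ite_zero]
  simp [funext_iff]

lemma ktfMat_mulVec (N d m : ℕ) (θ : (Fin d → Fin N) → ℝ) (j : Fin d) (r : Fin (N - m))
    (z : {l : Fin d // l ≠ j} → Fin N) :
    (ktfMat N d m).mulVec θ ⟨j, r, z⟩ =
      (Dop N m).mulVec (fun t => θ ((Equiv.funSplitAt j (Fin N)).symm (t, z))) r := by
  simp only [mulVec, dotProduct, ktfMat, of_apply]
  rw [← (Equiv.funSplitAt j (Fin N)).symm.sum_comp, Fintype.sum_prod_type]
  refine Finset.sum_congr rfl fun t _ => ?_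
  have h1 : ∀ z' : {l : Fin d // l ≠ j} → Fin N,
      (Equiv.funSplitAt j (Fin N)).symm (t, z') j = t := fun z' => by simp
  have h2 : ∀ z' : {l : Fin d // l ≠ j} → Fin N, ∀ l : {l : Fin d // l ≠ j},
      (Equiv.funSplitAt j (Fin N)).symm (t, z') l.1 = z' l := fun z' l => by simp [l.2]
  simp only [h1, h2, prod_ite_eq_ite_eq, mul_ite, mul_one, mul_zero, ite_mul, zero_mul,
    Finset.sum_ite_eq, Finset.mem_univ, if_true]

lemma ktfMat_transpose_mulVec (N d m : ℕ) (g : KtfIdx N d m → ℝ) (x : Fin d → Fin N) :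
    (ktfMat N d m)ᵀ.mulVec g x =
      ∑ j, ∑ r, Dop N m r (x j) * g ⟨j, r, fun l => x l⟩ := by
  simp only [mulVec, dotProduct, transpose_apply, ktfMat, of_apply]
  rw [Fintype.sum_sigma]
  refine Finset.sum_congr rfl fun j _ => ?_
  rw [Fintype.sum_prod_type]
  refine Finset.sum_congr rfl fun r _ => ?_
  have h : ∀ z : {l : Fin d // l ≠ j} → Fin N,
      (∏ l, (if z l = x l.1 then (1 : ℝ) else 0)) = if z = fun l => x l.1 then 1 else 0 :=
    fun z => prod_ite_eq_ite_eq z fun l => x l.1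
  simp only [h, mul_ite, mul_one, mul_zero, ite_mul, zero_mul, Finset.sum_ite_eq',
    Finset.mem_univ, if_true]

/-- Tensor products of univariate vectors. -/
def tensorVec {N d : ℕ} (u : Fin N → Fin N → ℝ) (i x : Fin d → Fin N) : ℝ :=
  ∏ l, u (i l) (x l)

lemma tensorVec_orthonormal {N d : ℕ} (u : Fin N → Fin N → ℝ)
    (hu : ∀ a b, ∑ x, u a x * u b x = if a = b then (1 : ℝ) else 0) (i i' : Fin d → Fin N) :
    ∑ x, tensorVec u i x * tensorVec u i' x = if i = i' then (1 : ℝ) else 0 := by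
  simp only [tensorVec, ← Finset.prod_mul_distrib]
  rw [← Fintype.prod_sum (fun l t => u (i l) t * u (i' l) t)]
  simp only [hu]
  exact prod_ite_eq_ite_eq i i'

lemma tensorVec_eigen {N d m : ℕ} (u : Fin N → Fin N → ℝ) (ρ : Fin N → ℝ)
    (heig : ∀ i, ((Dop N m)ᵀ * Dop N m).mulVec (u i) = ρ i • u i) (i : Fin d → Fin N) :
    ((ktfMat N d m)ᵀ * ktfMat N d m).mulVec (tensorVec u i) =
      (∑ j, ρ (i j)) • tensorVec u i := by
  have hK : ∀ j r z, (ktfMat N d m).mulVec (tensorVec u i) ⟨j, r, z⟩ =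
      (Dop N m).mulVec (u (i j)) r * ∏ l : {l : Fin d // l ≠ j}, u (i l) (z l) := by
    intro j r z
    rw [ktfMat_mulVec]
    have h : ∀ t, tensorVec u i ((Equiv.funSplitAt j (Fin N)).symm (t, z)) =
        u (i j) t * ∏ l : {l : Fin d // l ≠ j}, u (i l) (z l) := by
      intro t
      rw [tensorVec, Fintype.prod_eq_mul_prod_subtype_ne _ j]
      congr 1
      · simp
      · exact Finset.prod_congr rfl fun l _ => by simp [l.2]
    simp only [h, mulVec, dotProduct, Finset.sum_mul, mul_assoc]
  ext x
  rw [← mulVec_mulVec, ktfMat_transpose_mulVec, Pi.smul_apply, smul_eq_mul, Finset.sum_mul]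
  refine Finset.sum_congr rfl fun j _ => ?_
  have h := congrFun (heig (i j)) (x j)
  rw [← mulVec_mulVec] at h
  rw [tensorVec, Fintype.prod_eq_mul_prod_subtype_ne _ j, ← mul_assoc, ← smul_eq_mul (ρ (i j)),
    ← Pi.smul_apply, ← h]
  simp only [hK]
  simp only [mulVec, dotProduct, transpose_apply, Finset.sum_mul, mul_assoc]

lemma exists_orthonormal_eigenvectors {N : ℕ} (A : Matrix (Fin N) (Fin N) ℝ) (hA : A.IsHermitian)
    (ρ : Fin N → ℝ) (π : Equiv.Perm (Fin N)) (hπ : ∀ i, ρ i = hA.eigenvalues (π i)) :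
    ∃ u : Fin N → Fin N → ℝ,
      (∀ a b, ∑ x, u a x * u b x = if a = b then (1 : ℝ) else 0) ∧
      ∀ i, A.mulVec (u i) = ρ i • u i := by
  refine ⟨fun i => hA.eigenvectorBasis (π i), fun a b => ?_, fun i => ?_⟩
  · have h := orthonormal_iff_ite.1 hA.eigenvectorBasis.orthonormal (π b) (π a)
    simp only [EuclideanSpace.inner_eq_star_dotProduct, dotProduct, π.injective.eq_iff] at h
    simp only [eq_comm (a := a)]
    rw [← h]
    simp
  · rw [hA.mulVec_eigenvectorBasis, hπ]

/-- Orthogonal projection onto the span of the vectors `v i`, `i ∈ Q`. -/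
def projEst {ι : Type*} [Fintype ι] (v : ι → ι → ℝ) (Q : Finset ι) (y : ι → ℝ) (x : ι) : ℝ :=
  ∑ i ∈ Q, (∑ x', v i x' * y x') * v i x

lemma eq_sum_coeff_mul {ι : Type*} [Fintype ι] [DecidableEq ι] (v : ι → ι → ℝ)
    (hv : ∀ i i', ∑ x, v i x * v i' x = if i = i' then (1 : ℝ) else 0) (θ : ι → ℝ) (x : ι) :
    θ x = ∑ i, (∑ x', v i x' * θ x') * v i x := by
  have h1 : (Matrix.of v) * (Matrix.of v)ᵀ = 1 := by
    ext i i'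
    rw [mul_apply, one_apply]
    exact hv i i'
  have h2 := mul_eq_one_comm.1 h1
  calc θ x = ((Matrix.of v)ᵀ * Matrix.of v).mulVec θ x := by rw [h2, one_mulVec]
    _ = _ := by
      rw [← mulVec_mulVec]
      simp only [mulVec, dotProduct, transpose_apply, of_apply, mul_comm (v _ x)]

lemma riskE_projEst {ι : Type*} [Fintype ι] [DecidableEq ι] (v : ι → ι → ℝ)
    (hv : ∀ i i', ∑ x, v i x * v i' x = if i = i' then (1 : ℝ) else 0) (Q : Finset ι)
    (θ : ι → ℝ) (σ : ℝ) :
    riskE (projEst v Q) θ σ = (Fintype.card ι : ℝ≥0∞)⁻¹ *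
      ENNReal.ofReal (σ ^ 2 * Q.card + ∑ i ∈ Qᶜ, (∑ x, v i x * θ x) ^ 2) := by
  rw [riskE]
  congr 1
  have hpt : ∀ y, ∑ x, (projEst v Q y x - θ x) ^ 2 =
      ∑ i ∈ Q, (∑ x, v i x * (y x - θ x)) ^ 2 + ∑ i ∈ Qᶜ, (∑ x, v i x * θ x) ^ 2 := by
    intro y
    set c : ι → ℝ := fun i =>
      if i ∈ Q then ∑ x, v i x * (y x - θ x) else -∑ x, v i x * θ x with hc
    have hx : ∀ x, projEst v Q y x - θ x = ∑ i, c i * v i x := by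
      intro x
      rw [eq_sum_coeff_mul v hv θ x, projEst, ← Finset.sum_add_sum_compl Q,
        ← Finset.sum_add_sum_compl Q (fun i => c i * v i x), ← sub_sub,
        ← Finset.sum_sub_distrib, sub_eq_add_neg, ← Finset.sum_neg_distrib]
      congr 1
      · refine Finset.sum_congr rfl fun i hi => ?_
        simp only [hc, if_pos hi, mul_sub, Finset.sum_sub_distrib, sub_mul]
      · refine Finset.sum_congr rfl fun i hi => ?_
        simp only [hc, if_neg (Finset.mem_compl.1 hi), neg_mul]
    simp only [hx]
    rw [sum_sq_lincomb_orthonormal v hv, ← Finset.sum_add_sum_compl Q]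
    congr 1
    · exact Finset.sum_congr rfl fun i hi => by simp only [hc, if_pos hi]
    · exact Finset.sum_congr rfl fun i hi => by
        simp only [hc, if_neg (Finset.mem_compl.1 hi), neg_sq]
  have hb : 0 ≤ ∑ i ∈ Qᶜ, (∑ x, v i x * θ x) ^ 2 := Finset.sum_nonneg fun _ _ => sq_nonneg _
  have hq : ∀ y : ι → ℝ, 0 ≤ ∑ i ∈ Q, (∑ x, v i x * (y x - θ x)) ^ 2 :=
    fun y => Finset.sum_nonneg fun _ _ => sq_nonneg _
  have hm : ∀ i, Measurable fun y : ι → ℝ =>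
      ENNReal.ofReal ((∑ x, v i x * (y x - θ x)) ^ 2) := fun i => by fun_prop
  simp only [hpt]
  calc ∫⁻ y, ENNReal.ofReal (∑ i ∈ Q, (∑ x, v i x * (y x - θ x)) ^ 2
          + ∑ i ∈ Qᶜ, (∑ x, v i x * θ x) ^ 2) ∂(gaussSeq θ σ)
      = ∫⁻ y, (∑ i ∈ Q, ENNReal.ofReal ((∑ x, v i x * (y x - θ x)) ^ 2))
          + ENNReal.ofReal (∑ i ∈ Qᶜ, (∑ x, v i x * θ x) ^ 2) ∂(gaussSeq θ σ) := by
        refine lintegral_congr fun y => ?_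
        rw [ENNReal.ofReal_add (hq y) hb, ENNReal.ofReal_sum_of_nonneg fun _ _ => sq_nonneg _]
    _ = _ := by
        rw [lintegral_add_right _ measurable_const, lintegral_finsetSum _ fun i _ => hm i]
        have h1 : ∀ i, ∑ x, v i x ^ 2 = 1 := fun i => by
          have := hv i i
          simpa [sq] using this
        simp only [lintegral_sq_linear_gaussSeq, h1, mul_one, lintegral_const, measure_univ]
        rw [← ENNReal.ofReal_sum_of_nonneg fun _ _ => sq_nonneg _,
          ← ENNReal.ofReal_add (Finset.sum_nonneg fun _ _ => sq_nonneg _) hb]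
        simp [mul_comm]

lemma eigenvalue_nonneg {N m : ℕ} (u : Fin N → Fin N → ℝ) (ρ : Fin N → ℝ)
    (hu : ∀ a b, ∑ x, u a x * u b x = if a = b then (1 : ℝ) else 0)
    (heig : ∀ i, ((Dop N m)ᵀ * Dop N m).mulVec (u i) = ρ i • u i) (a : Fin N) : 0 ≤ ρ a := by
  have h := sum_sq_mulVec_lincomb_eigen (Dop N m) u hu ρ heig (Pi.single a 1)
  have h2 : ∑ b, ρ b * (Pi.single a (1 : ℝ) : Fin N → ℝ) b ^ 2 = ρ a := by
    rw [Finset.sum_eq_single a]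
    · simp
    · intro b _ hb
      simp [Pi.single_eq_of_ne hb]
    · simp
  rw [← h2, ← h]
  exact Finset.sum_nonneg fun _ _ => sq_nonneg _

/-- Bias of the projection onto the eigenvectors indexed by `{1,…,τ}^d`. -/
lemma bias_le {N d k L r τ : ℕ} {B : ℝ} (hL : 0 < L) (hr : N ≤ L * r)
    (hτ : min N ((k + 1) * r) ≤ τ)
    (u : Fin N → Fin N → ℝ) (ρ : Fin N → ℝ) (hρ : Monotone ρ)
    (hu : ∀ a b, ∑ x, u a x * u b x = if a = b then (1 : ℝ) else 0)
    (heig : ∀ i, ((Dop N (k + 1))ᵀ * Dop N (k + 1)).mulVec (u i) = ρ i • u i)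
    (v : (Fin d → Fin N) → (Fin d → Fin N) → ℝ)
    (hv : ∀ i i', ∑ x, v i x * v i' x = if i = i' then (1 : ℝ) else 0)
    (hve : ∀ i, ((ktfMat N d (k + 1))ᵀ * ktfMat N d (k + 1)).mulVec (v i) =
      (∑ j, ρ (i j)) • v i) (θ : (Fin d → Fin N) → ℝ) (hθ : θ ∈ sobolevClass N d k B) :
    ∑ i ∈ (Finset.univ.filter (fun i : Fin d → Fin N => ∀ j, (i j : ℕ) < τ))ᶜ,
      (∑ x, v i x * θ x) ^ 2 ≤ (L : ℝ) ^ (2 * (k + 1)) * B ^ 2 := by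
  have hρ0 := eigenvalue_nonneg u ρ hu heig
  have hexp : θ = fun x => ∑ i, (∑ x', v i x' * θ x') * v i x :=
    funext (eq_sum_coeff_mul v hv θ)
  have hD : ∑ i, (∑ j, ρ (i j)) * (∑ x, v i x * θ x) ^ 2 ≤ B ^ 2 := by
    rw [← sum_sq_mulVec_lincomb_eigen (ktfMat N d (k + 1)) v hv _ hve, ← hexp]
    exact Real.sqrt_le_left (le_trans (Real.sqrt_nonneg _) hθ) |>.1 hθ
  refine le_trans ?_ (mul_le_mul_of_nonneg_left hD (by positivity))
  rw [Finset.mul_sum]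
  refine le_trans (Finset.sum_le_sum (g := fun i => (L : ℝ) ^ (2 * (k + 1)) *
    ((∑ j, ρ (i j)) * (∑ x, v i x * θ x) ^ 2)) fun i hi => ?_)
    (Finset.sum_le_sum_of_subset_of_nonneg (Finset.subset_univ _) fun i _ _ => ?_)
  · simp only [Finset.mem_compl, Finset.mem_filter, Finset.mem_univ, true_and, not_forall,
      not_lt] at hi
    obtain ⟨j, hj⟩ := hi
    have hlow := one_le_pow_mul_eigenvalue N (k + 1) L r hL hr u ρ hρ hu heig (i j)
      (by have := (i j).2; omega)
    have hle : ρ (i j) ≤ ∑ j, ρ (i j) :=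
      Finset.single_le_sum (f := fun j => ρ (i j)) (fun j _ => hρ0 _) (Finset.mem_univ j)
    rw [← mul_assoc]
    refine le_mul_of_one_le_left (sq_nonneg _) (hlow.trans ?_)
    exact mul_le_mul_of_nonneg_left hle (by positivity)
  · exact mul_nonneg (by positivity)
      (mul_nonneg (Finset.sum_nonneg fun j _ => hρ0 _) (sq_nonneg _))

lemma abs_fwdDiff_iter_le (m : ℕ) (f : ℝ → ℝ) (hf : ContDiff ℝ m f) (K : ℝ)
    (hK : ∀ x, |iteratedDeriv m f x| ≤ K) (δ : ℝ) (hδ : 0 ≤ δ) (x : ℝ) :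
    |(fwdDiff δ)^[m] f x| ≤ δ ^ m * K := by
  induction m generalizing f K x with
  | zero => simpa using hK x
  | succ m ih =>
    have hfm : ContDiff ℝ m f := hf.of_le (by norm_cast; omega)
    have hshift : ContDiff ℝ m fun y => f (y + δ) := hfm.comp (by fun_prop)
    have hdiff : Differentiable ℝ (iteratedDeriv m f) :=
      hf.differentiable_iteratedDeriv m (by norm_cast; omega)
    rw [Function.iterate_succ_apply, pow_succ, mul_assoc]
    refine ih (fwdDiff δ f) (hshift.sub hfm) (δ * K) (fun y => ?_) x
    have h1 : iteratedDeriv m (fwdDiff δ f) y =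
        iteratedDeriv m f (y + δ) - iteratedDeriv m f y := by
      have h := iteratedDeriv_fun_sub (n := m) (x := y) hshift.contDiffAt hfm.contDiffAt
      rw [iteratedDeriv_comp_add_const] at h
      exact h
    have h2 := convex_univ.norm_image_sub_le_of_norm_deriv_le (f := iteratedDeriv m f) (C := K)
      (fun z _ => hdiff z) (fun z _ => by rw [← iteratedDeriv_succ]; exact hK z)
      (Set.mem_univ y) (Set.mem_univ (y + δ))
    rw [h1]
    simpa [abs_of_nonneg hδ, mul_comm] using h2

lemma fwdDiff_iter_sample (m : ℕ) (f : ℝ → ℝ) (δ c : ℝ) (i : ℕ) :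
    (fwdDiff 1)^[m] (fun i : ℕ => f (i * δ + c)) i = (fwdDiff δ)^[m] f (i * δ + c) := by
  simp only [fwdDiff_iter_eq_sum_shift]
  refine Finset.sum_congr rfl fun t _ => ?_
  congr 2
  simp
  ring

lemma exists_abs_fwdDiff_iter_bump_le (m : ℕ) (f : ContDiffBump (0 : ℝ)) :
    ∃ K : ℝ, 0 ≤ K ∧ ∀ δ : ℝ, 0 ≤ δ → ∀ x, |(fwdDiff δ)^[m] f x| ≤ δ ^ m * K := by
  have hc : ContDiff ℝ m f := f.contDiff
  have hs : HasCompactSupport (iteratedFDeriv ℝ m f) := f.hasCompactSupport.iteratedFDeriv m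
  obtain ⟨K, hK⟩ := (hc.continuous_iteratedFDeriv le_rfl).bounded_above_of_compact_support hs
  have hK' : ∀ x, |iteratedDeriv m f x| ≤ K := fun x => by
    rw [← Real.norm_eq_abs, ← norm_iteratedFDeriv_eq_norm_iteratedDeriv]
    exact hK x
  exact ⟨K, (abs_nonneg _).trans (hK' 0), abs_fwdDiff_iter_le m f hc K hK'⟩

/-- A sequence made of translated bumps, one in each block of length `L`, whose differences of
order `m` are small uniformly over blockwise changes of sign. -/
lemma exists_block_bumps (m : ℕ) : ∃ K : ℝ, 0 ≤ K ∧ ∀ L : ℕ, 0 < L → ∃ g : ℕ → ℝ,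
    (∀ i, 0 ≤ g i) ∧ (∀ i, g i ≤ 1) ∧
    (∀ N, L ≤ N → (N : ℝ) / 8 ≤ ∑ i ∈ Finset.range N, g i ^ 2) ∧
    ∀ ω : ℕ → ℝ, (∀ b, |ω b| ≤ 1) → ∀ i,
      |(fwdDiff 1)^[m] (fun i => ω (i / L) * g i) i| ≤ K / L ^ m := by
  set f : ContDiffBump (0 : ℝ) := ⟨1 / 4, 1 / 2, by norm_num, by norm_num⟩ with hf
  obtain ⟨K, hK0, hK⟩ := exists_abs_fwdDiff_iter_bump_le m f
  refine ⟨(m + 1) * K, by positivity, fun L hL => ?_⟩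
  have hL' : (0 : ℝ) < L := by exact_mod_cast hL
  set ψ : ℕ → ℕ → ℝ := fun b i => f (i * (1 / L : ℝ) + (1 / (2 * L) - b - 1 / 2)) with hψ
  have hψ0 : ∀ b i, b ≠ i / L → ψ b i = 0 := by
    intro b i hb
    refine f.zero_of_le_dist ?_
    simp only [hf, Real.dist_eq, sub_zero]
    by_contra hcon
    rw [not_le, abs_lt] at hcon
    refine hb ((Nat.div_eq_of_lt_le ?_ ?_).symm)
    · have h : ((b : ℝ) * L : ℝ) < i + 1 := by
        have h := mul_lt_mul_of_pos_right hcon.1 hL'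
        field_simp at h
        nlinarith
      exact Nat.lt_succ_iff.1 (by exact_mod_cast h)
    · have h : (i : ℝ) < (b + 1) * L := by
        have h := mul_lt_mul_of_pos_right hcon.2 hL'
        field_simp at h
        nlinarith
      exact_mod_cast h
  refine ⟨fun i => ψ (i / L) i, fun i => f.nonneg, fun i => f.le_one, fun N hN => ?_,
    fun ω hω i => ?_⟩
  · have hone : ∀ j ∈ Finset.Ico ((L + 1) / 4) ((3 * L + 2) / 4), ∀ q,
        ψ ((L * q + j) / L) (L * q + j) = 1 := by
      intro j hj q
      rw [Finset.mem_Ico] at hj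
      have hjL : j < L := by omega
      have h1 : (L : ℝ) ≤ 4 * j + 2 := by exact_mod_cast (by omega : L ≤ 4 * j + 2)
      have h2 : (4 * j + 2 : ℝ) ≤ 3 * L := by exact_mod_cast (by omega : 4 * j + 2 ≤ 3 * L)
      rw [Nat.mul_add_div hL, Nat.div_eq_of_lt hjL, add_zero]
      refine f.one_of_mem_closedBall ?_
      simp only [hf, Metric.mem_closedBall, Real.dist_eq, sub_zero]
      have e : (((L * q + j : ℕ) : ℝ) * (1 / L : ℝ) + (1 / (2 * L) - q - 1 / 2)) =
          (4 * j + 2 - 2 * L) / (4 * L) := by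
        push_cast
        field_simp
        ring
      rw [e, abs_le, le_div_iff₀ (by positivity), div_le_iff₀ (by positivity)]
      constructor <;> linarith
    have hblock : ∀ q, (L : ℝ) / 4 ≤
        ∑ j ∈ Finset.range L, ψ ((L * q + j) / L) (L * q + j) ^ 2 := by
      intro q
      have hsub : Finset.Ico ((L + 1) / 4) ((3 * L + 2) / 4) ⊆ Finset.range L := by
        intro j hj
        rw [Finset.mem_Ico] at hj
        rw [Finset.mem_range]
        omega
      refine le_trans ?_ (Finset.sum_le_sum_of_subset_of_nonneg hsub fun _ _ _ => sq_nonneg _)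
      rw [Finset.sum_congr rfl fun j hj => by rw [hone j hj q]]
      have : (L : ℝ) ≤ 4 * ((3 * L + 2) / 4 - (L + 1) / 4 : ℕ) := by
        exact_mod_cast (by omega : L ≤ 4 * ((3 * L + 2) / 4 - (L + 1) / 4))
      simp only [one_pow, Finset.sum_const, Nat.card_Ico, nsmul_eq_mul, mul_one]
      linarith
    have hsum : ∀ q : ℕ, q * ((L : ℝ) / 4) ≤ ∑ i ∈ Finset.range (L * q), ψ (i / L) i ^ 2 := by
      intro q
      induction q with
      | zero => simp
      | succ q ih =>
        rw [Nat.mul_succ, Finset.sum_range_add]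
        have := hblock q
        push_cast
        linarith
    have hq := hsum (N / L)
    have hq1 : 1 ≤ N / L := (Nat.one_le_div_iff hL).2 hN
    have hmod : L * (N / L) + N % L = N := Nat.div_add_mod N L
    have hlt : N % L < L := Nat.mod_lt N hL
    have hqL : L ≤ L * (N / L) := Nat.le_mul_of_pos_right L hq1
    have h2 : (N : ℝ) ≤ 2 * (L * (N / L : ℕ)) := by
      exact_mod_cast (by omega : N ≤ 2 * (L * (N / L)))
    have hmono : ∑ i ∈ Finset.range (L * (N / L)), ψ (i / L) i ^ 2 ≤
        ∑ i ∈ Finset.range N, ψ (i / L) i ^ 2 :=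
      Finset.sum_le_sum_of_subset_of_nonneg
        (Finset.range_subset_range.2 (by omega)) fun _ _ _ => sq_nonneg _
    linarith
  · set I : Finset ℕ := (Finset.range (m + 1)).image fun t => (i + t) / L with hI
    have hcongr : (fwdDiff 1)^[m] (fun i => ω (i / L) * ψ (i / L) i) i =
        (fwdDiff 1)^[m] (∑ b ∈ I, ω b • ψ b) i := by
      simp only [fwdDiff_iter_eq_sum_shift]
      refine Finset.sum_congr rfl fun t ht => ?_
      congr 1
      simp only [Finset.sum_apply, Pi.smul_apply, smul_eq_mul, mul_one]
      rw [Finset.sum_eq_single ((i + t) / L)]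
      · intro b _ hb
        rw [hψ0 b _ hb, mul_zero]
      · intro h
        exact absurd (Finset.mem_image_of_mem _ ht) h
    have hb : ∀ b, |(fwdDiff 1)^[m] (ω b • ψ b) i| ≤ K / L ^ m := by
      intro b
      rw [fwdDiff_iter_const_smul, Pi.smul_apply, smul_eq_mul, abs_mul, hψ, fwdDiff_iter_sample]
      refine (mul_le_of_le_one_left (abs_nonneg _) (hω b)).trans ?_
      refine (hK _ (by positivity) _).trans (le_of_eq ?_)
      rw [one_div, inv_pow, inv_mul_eq_div]
    rw [hcongr, fwdDiff_iter_finsetSum, Finset.sum_apply]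
    refine (Finset.abs_sum_le_sum_abs _ _).trans ((Finset.sum_le_sum fun b _ => hb b).trans ?_)
    rw [Finset.sum_const, nsmul_eq_mul, mul_div_assoc]
    refine mul_le_mul_of_nonneg_right ?_ (by positivity)
    have : I.card ≤ m + 1 := Finset.card_image_le.trans (by simp)
    exact_mod_cast this

lemma mem_sobolevClass_of_abs_le {N d k : ℕ} (hd : 1 ≤ d) {B M : ℝ} (hB : 0 ≤ B)
    (θ : (Fin d → Fin N) → ℝ) (hθ : ∀ p, |(ktfMat N d (k + 1)).mulVec θ p| ≤ M)
    (hM : d * (N ^ d : ℕ) * M ^ 2 ≤ B ^ 2) : θ ∈ sobolevClass N d k B := by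
  refine Real.sqrt_le_iff.2 ⟨hB, le_trans ?_ hM⟩
  have hcard : Fintype.card (KtfIdx N d (k + 1)) ≤ d * N ^ d := by
    have hj : ∀ j : Fin d, Fintype.card {l : Fin d // l ≠ j} = d - 1 := fun j => by simp
    simp only [Fintype.card_sigma, Fintype.card_prod, Fintype.card_fin, Fintype.card_fun,
      hj, Finset.sum_const, Finset.card_univ, smul_eq_mul]
    obtain ⟨e, rfl⟩ : ∃ e, d = e + 1 := ⟨d - 1, by omega⟩
    refine Nat.mul_le_mul_left _ ?_
    rw [Nat.add_sub_cancel, pow_succ, mul_comm (N ^ e)]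
    exact Nat.mul_le_mul_right _ (Nat.sub_le _ _)
  calc ∑ p, (ktfMat N d (k + 1)).mulVec θ p ^ 2
      ≤ ∑ _p : KtfIdx N d (k + 1), M ^ 2 := Finset.sum_le_sum fun p _ => by
        rw [← sq_abs]; exact pow_le_pow_left₀ (abs_nonneg _) (hθ p) 2
    _ = Fintype.card (KtfIdx N d (k + 1)) * M ^ 2 := by simp
    _ ≤ _ := mul_le_mul_of_nonneg_right (by exact_mod_cast hcard) (sq_nonneg _)

lemma inv_card_mul_ofReal {N d : ℕ} (hn : 0 < N ^ d) (a : ℝ) :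
    (Fintype.card (Fin d → Fin N) : ℝ≥0∞)⁻¹ * ENNReal.ofReal a =
      ENNReal.ofReal (a / (N ^ d : ℕ)) := by
  have hn' : (0 : ℝ) < (N ^ d : ℕ) := by exact_mod_cast hn
  rw [ENNReal.ofReal_div_of_pos hn', ENNReal.ofReal_natCast, ENNReal.div_eq_inv_mul]
  simp

lemma parametric_le_minimaxRisk {N d k : ℕ} (hd : 1 ≤ d) (hn : 0 < N ^ d) {σ B : ℝ} (hσ : 0 < σ)
    (hB : 0 < B) :
    ENNReal.ofReal (Real.exp (-1) * σ ^ 2 / (N ^ d : ℕ)) ≤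
      minimaxRisk (sobolevClass N d k B) σ := by
  have hn' : (0 : ℝ) < (N ^ d : ℕ) := by exact_mod_cast hn
  have hsum : ∑ _x : Fin d → Fin N, (σ / √((N ^ d : ℕ) : ℝ)) ^ 2 = σ ^ 2 := by
    rw [Finset.sum_const, Finset.card_univ, Fintype.card_pi_const, Fintype.card_fin, nsmul_eq_mul,
      div_pow, Real.sq_sqrt hn'.le]
    field_simp
  have h := assouad_minimaxRisk (S := Unit) (sobolevClass N d k B) (fun _ => ())
    (fun _ => σ / √((N ^ d : ℕ) : ℝ)) hσ (fun _ => by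
      rw [Finset.filter_true_of_mem fun _ _ => Subsingleton.elim _ _]; exact hsum.le)
    (fun ω => ?_)
  · rwa [hsum, inv_card_mul_ofReal hn] at h
  · refine mem_sobolevClass_of_abs_le (M := 0) hd hB.le _ (fun p => ?_) (by simp; positivity)
    obtain ⟨j, r, z⟩ := p
    rw [ktfMat_mulVec]
    have := Dop_mulVec N (k + 1)
      (fun _ => (if ω () then 1 else -1) * (σ / √((N ^ d : ℕ) : ℝ))) r
    have h0 : (fwdDiff 1)^[k + 1] (fun _ : ℕ =>
        (if ω () then (1 : ℝ) else -1) * (σ / √((N ^ d : ℕ) : ℝ))) r = 0 := by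
      rw [Function.iterate_succ_apply, fwdDiff_const]
      have hz : ∀ j : ℕ, (fwdDiff 1)^[j] (fun _ : ℕ => (0 : ℝ)) = fun _ => 0 := fun j =>
        Function.iterate_fixed (fwdDiff_const 1 (0 : ℝ)) j
      rw [hz]
    rw [h0] at this
    simp only [signedVec]
    rw [this, abs_zero]

lemma card_filter_div_eq_le {N d L : ℕ} (hL : 0 < L) (s : Fin d → Fin N) :
    (Finset.univ.filter fun x : Fin d → Fin N =>
      (fun l => (⟨(x l : ℕ) / L, (Nat.div_le_self _ _).trans_lt (x l).2⟩ : Fin N)) = s).card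
      ≤ L ^ d := by
  have hc : (Finset.univ : Finset (Fin d → Fin L)).card = L ^ d := by simp
  rw [← hc]
  refine Finset.card_le_card_of_injOn (fun x l => ⟨(x l : ℕ) % L, Nat.mod_lt _ hL⟩)
    (fun _ _ => Finset.mem_coe.2 (Finset.mem_univ _)) ?_
  intro x hx y hy hxy
  simp only [Finset.coe_filter, Finset.mem_univ, true_and, Set.mem_ofPred_eq] at hx hy
  ext l
  have h1 := congrFun hx l
  have h2 := congrFun hy l
  have h3 := congrFun hxy l
  simp only [Fin.ext_iff] at h1 h2 h3
  rw [← Nat.div_add_mod (x l : ℕ) L, ← Nat.div_add_mod (y l : ℕ) L, h1, h2, h3]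

/-- Nonparametric lower bound from a hypercube of bumps of width `L`. -/
lemma exists_bump_le_minimaxRisk (k d : ℕ) (hd : 1 ≤ d) (σ : ℝ) (hσ : 0 < σ) :
    ∃ A : ℝ, 1 ≤ A ∧ ∀ N : ℕ, 0 < N → ∀ B : ℝ, 0 < B → ∀ L : ℕ, 0 < L → L ≤ N →
      A * (N ^ d : ℕ) ≤ B ^ 2 * L ^ (2 * (k + 1) + d) →
      ENNReal.ofReal (Real.exp (-1) * σ ^ 2 / (8 * L) ^ d) ≤
        minimaxRisk (sobolevClass N d k B) σ := by
  obtain ⟨K, hK0, hK⟩ := exists_block_bumps (k + 1)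
  refine ⟨max 1 (d * σ ^ 2 * K ^ 2), le_max_left _ _, fun N hN B hB L hL hLN hA => ?_⟩
  obtain ⟨g, hg0, hg1, hgsum, hg⟩ := hK L hL
  have hn : 0 < N ^ d := by positivity
  have hn' : (0 : ℝ) < (N ^ d : ℕ) := by exact_mod_cast hn
  have hL' : (0 : ℝ) < L := by exact_mod_cast hL
  set a : ℝ := σ / √((L : ℝ) ^ d) with ha
  have ha0 : 0 < a := by positivity
  have ha2 : a ^ 2 = σ ^ 2 / L ^ d := by rw [ha, div_pow, Real.sq_sqrt (by positivity)]
  set Φ : (Fin d → Fin N) → ℝ := fun x => a * ∏ l, g (x l) with hΦ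
  set blk : (Fin d → Fin N) → (Fin d → Fin N) := fun x l =>
    ⟨(x l : ℕ) / L, (Nat.div_le_self _ _).trans_lt (x l).2⟩ with hblk
  have hΦle : ∀ x, Φ x ^ 2 ≤ a ^ 2 := by
    intro x
    have h0 : 0 ≤ ∏ l, g (x l) := Finset.prod_nonneg fun l _ => hg0 _
    have h1 : ∏ l, g (x l) ≤ 1 := Finset.prod_le_one (fun l _ => hg0 _) fun l _ => hg1 _
    rw [hΦ, mul_pow]
    exact mul_le_of_le_one_right (sq_nonneg _) (pow_le_one₀ h0 h1)
  have hsum : ∑ x, Φ x ^ 2 = a ^ 2 * (∑ i ∈ Finset.range N, g i ^ 2) ^ d := by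
    simp only [hΦ, mul_pow, ← Finset.prod_pow]
    rw [← Finset.mul_sum, Finset.sum_range, ← Fintype.prod_sum (fun (_ : Fin d) (t : Fin N) => g t ^ 2)]
    simp
  have h := assouad_minimaxRisk (sobolevClass N d k B) blk Φ hσ (fun s => ?_) (fun ω => ?_)
  · rw [inv_card_mul_ofReal hn] at h
    refine le_trans (ENNReal.ofReal_le_ofReal ?_) h
    have h8 : ((N : ℝ) / 8) ^ d ≤ (∑ i ∈ Finset.range N, g i ^ 2) ^ d :=
      pow_le_pow_left₀ (by positivity) (hgsum N hLN) d
    rw [hsum, ha2, le_div_iff₀ hn']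
    calc Real.exp (-1) * σ ^ 2 / (8 * L) ^ d * (N ^ d : ℕ)
        = Real.exp (-1) * (σ ^ 2 / L ^ d * ((N : ℝ) / 8) ^ d) := by
          push_cast
          rw [mul_pow, div_pow]
          field_simp
      _ ≤ _ := by gcongr
  · calc ∑ x with blk x = s, Φ x ^ 2 ≤ ∑ x with blk x = s, a ^ 2 :=
          Finset.sum_le_sum fun x _ => hΦle x
      _ = (Finset.univ.filter fun x => blk x = s).card * a ^ 2 := by simp
      _ ≤ (L : ℝ) ^ d * a ^ 2 := by
          refine mul_le_mul_of_nonneg_right ?_ (sq_nonneg _)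
          exact_mod_cast card_filter_div_eq_le hL s
      _ = σ ^ 2 := by rw [ha2]; field_simp
  · refine mem_sobolevClass_of_abs_le (M := a * (K / L ^ (k + 1))) hd hB.le _ (fun p => ?_) ?_
    · obtain ⟨j, r, z⟩ := p
      rw [ktfMat_mulVec]
      set b : ℝ := a * ∏ l : {l : Fin d // l ≠ j}, g (z l) with hb
      have hba : |b| ≤ a := by
        have h0 : 0 ≤ ∏ l : {l : Fin d // l ≠ j}, g (z l) := Finset.prod_nonneg fun l _ => hg0 _
        have h1 : ∏ l : {l : Fin d // l ≠ j}, g (z l) ≤ 1 :=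
          Finset.prod_le_one (fun l _ => hg0 _) fun l _ => hg1 _
        rw [hb, abs_of_nonneg (by positivity)]
        exact mul_le_of_le_one_right ha0.le h1
      set ε : ℕ → ℝ := fun β => if h : β < N then
        (if ω (fun l => if hl : l = j then ⟨β, h⟩ else
          ⟨(z ⟨l, hl⟩ : ℕ) / L, (Nat.div_le_self _ _).trans_lt (z ⟨l, hl⟩).2⟩) then 1 else -1)
        else 0 with hε
      have hε1 : ∀ β, |ε β| ≤ 1 := by
        intro β
        simp only [hε]
        split_ifs <;> simp
      have hfib : (fun t : Fin N =>
          signedVec blk Φ ω ((Equiv.funSplitAt j (Fin N)).symm (t, z))) =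
          fun t : Fin N => (b • fun i : ℕ => ε (i / L) * g i) (t : ℕ) := by
        ext t
        have ht : (t : ℕ) / L < N := (Nat.div_le_self _ _).trans_lt t.2
        have hblkt : blk ((Equiv.funSplitAt j (Fin N)).symm (t, z)) =
            fun l => if hl : l = j then ⟨(t : ℕ) / L, ht⟩ else
              ⟨(z ⟨l, hl⟩ : ℕ) / L, (Nat.div_le_self _ _).trans_lt (z ⟨l, hl⟩).2⟩ := by
          ext l
          simp only [hblk, Equiv.funSplitAt_symm_apply]
          split_ifs <;> rfl
        have hΦt : Φ ((Equiv.funSplitAt j (Fin N)).symm (t, z)) = b * g t := by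
          simp only [hΦ]
          rw [Fintype.prod_eq_mul_prod_subtype_ne _ j, hb, mul_assoc,
            mul_comm (∏ _, _) (g t)]
          congr 2
          · simp
          · exact Finset.prod_congr rfl fun l _ => by simp [l.2]
        rw [signedVec, hblkt, hΦt]
        simp only [Pi.smul_apply, smul_eq_mul, hε, dif_pos ht]
        ring
      rw [hfib, Dop_mulVec, fwdDiff_iter_const_smul, Pi.smul_apply, smul_eq_mul, abs_mul]
      exact mul_le_mul hba (hg ε hε1 r) (abs_nonneg _) ha0.le
    · have hAK : d * σ ^ 2 * K ^ 2 * (N ^ d : ℕ) ≤ B ^ 2 * L ^ (2 * (k + 1) + d) :=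
        le_trans (mul_le_mul_of_nonneg_right (le_max_right _ _) hn'.le) hA
      have e : (d : ℝ) * (N ^ d : ℕ) * (a * (K / L ^ (k + 1))) ^ 2 =
          d * σ ^ 2 * K ^ 2 * (N ^ d : ℕ) / L ^ (2 * (k + 1) + d) := by
        rw [mul_pow, ha2, div_pow, ← pow_mul, pow_add, mul_comm (k + 1) 2]
        field_simp
      rw [e, div_le_iff₀ (by positivity)]
      exact hAK

/-- The bandwidth `x = (n / B²)^{1/(2(k+1)+d)}` balancing squared bias and variance. -/
lemma exists_bandwidth (k d N : ℕ) (hd : 1 ≤ d) (hn : 0 < N ^ d) (B : ℝ) (hB : 0 < B)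
    (hBn : B ≤ √((N ^ d : ℕ) : ℝ)) :
    ∃ x : ℝ, 1 ≤ x ∧ B ^ 2 * x ^ (2 * (k + 1) + d) = ((N ^ d : ℕ) : ℝ) ∧
      sobolevRate k d N B = 1 / ((N ^ d : ℕ) : ℝ) + 1 / x ^ d ∧
      (B ^ 2 * ((N ^ d : ℕ) : ℝ) ^ (2 * (((k : ℝ) + 1) / d))) ^
        ((1 : ℝ) / (2 * (((k : ℝ) + 1) / d) + 1)) = ((N ^ d : ℕ) : ℝ) / x ^ d ∧
      (B = ((N ^ d : ℕ) : ℝ) ^ ((1 : ℝ) / 2 - ((k : ℝ) + 1) / d) →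
        ((N ^ d : ℕ) : ℝ) ^
          (-(2 * (((k : ℝ) + 1) / d)) / (2 * (((k : ℝ) + 1) / d) + 1)) = 1 / x ^ d) := by
  have hn1 : (1 : ℝ) ≤ ((N ^ d : ℕ) : ℝ) := by exact_mod_cast hn
  have hd0 : (0 : ℝ) < d := by exact_mod_cast hd
  unfold sobolevRate
  generalize ((N ^ d : ℕ) : ℝ) = n at *
  have hn0 : 0 < n := by linarith
  set s : ℝ := ((k : ℝ) + 1) / d with hs
  have hs0 : 0 < s := by positivity
  have hB2 : B ^ 2 ≤ n := by
    rw [← Real.sq_sqrt hn0.le]; exact pow_le_pow_left₀ hB.le hBn 2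
  have hq : 1 ≤ n / B ^ 2 := (one_le_div (by positivity)).2 hB2
  have hq0 : 0 < n / B ^ 2 := by positivity
  have hx0 : 0 < (n / B ^ 2) ^ ((1 : ℝ) / (d * (2 * s + 1))) := Real.rpow_pos_of_pos hq0 _
  have hpow : ((n / B ^ 2) ^ ((1 : ℝ) / (d * (2 * s + 1)))) ^ (2 * (k + 1) + d) = n / B ^ 2 := by
    rw [← Real.rpow_natCast, ← Real.rpow_mul hq0.le]
    convert Real.rpow_one (n / B ^ 2) using 2
    push_cast
    rw [hs]
    field_simp
  have hxd : 1 / ((n / B ^ 2) ^ ((1 : ℝ) / (d * (2 * s + 1)))) ^ d =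
      (B ^ 2 / n) ^ ((1 : ℝ) / (2 * s + 1)) := by
    rw [← Real.rpow_natCast, ← Real.rpow_mul hq0.le, one_div, ← Real.inv_rpow hq0.le, inv_div]
    congr 1
    field_simp
  refine ⟨(n / B ^ 2) ^ ((1 : ℝ) / (d * (2 * s + 1))), Real.one_le_rpow hq (by positivity), ?_,
    ?_, ?_, ?_⟩
  · rw [hpow]; field_simp
  · rw [hxd, min_eq_left]
    exact Real.rpow_le_one (by positivity) ((div_le_one hn0).2 hB2) (by positivity)
  · rw [div_eq_mul_one_div n (_ ^ d), hxd, Real.mul_rpow (by positivity) (by positivity),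
      Real.div_rpow (by positivity) hn0.le, ← Real.rpow_mul hn0.le,
      mul_div_left_comm n]
    congr 1
    rw [eq_div_iff (by positivity), ← Real.rpow_add hn0]
    convert Real.rpow_one n using 2
    field_simp
  · intro hBs
    rw [hxd, hBs, ← Real.rpow_natCast, ← Real.rpow_mul hn0.le]
    nth_rewrite 3 [← Real.rpow_one n]
    rw [← Real.rpow_sub hn0, ← Real.rpow_mul hn0.le]
    congr 1
    push_cast
    field_simp
    ring

lemma minimaxRisk_lower (k d : ℕ) (hd : 1 ≤ d) (σ : ℝ) (hσ : 0 < σ) :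
    ∃ c : ℝ, 0 < c ∧ ∀ N : ℕ, 0 < N → ∀ B x : ℝ, 0 < B → 1 ≤ x →
      B ^ 2 * x ^ (2 * (k + 1) + d) = ((N ^ d : ℕ) : ℝ) →
      ENNReal.ofReal (c * (1 / ((N ^ d : ℕ) : ℝ) + 1 / x ^ d)) ≤
        minimaxRisk (sobolevClass N d k B) σ := by
  obtain ⟨A, hA1, hA⟩ := exists_bump_le_minimaxRisk k d hd σ hσ
  refine ⟨Real.exp (-1) * σ ^ 2 / (2 * (16 * A) ^ d), by positivity,
    fun N hN B x hB hx hBx => ?_⟩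
  have hn : 0 < N ^ d := by positivity
  have hn' : (0 : ℝ) < (N ^ d : ℕ) := by exact_mod_cast hn
  have hpar := parametric_le_minimaxRisk (k := k) hd hn hσ hB
  have hx0 : 0 < x := by linarith
  have hA0 : 0 < A := by linarith
  have hAx : 1 ≤ A * x := one_le_mul_of_one_le_of_one_le hA1 hx
  set E := Real.exp (-1) * σ ^ 2 with hE
  have hE0 : 0 < E := by positivity
  have hL1 : A * x ≤ ⌈A * x⌉₊ := Nat.le_ceil _
  have hL2 : (⌈A * x⌉₊ : ℝ) ≤ 2 * A * x := by
    have := Nat.ceil_lt_add_one (a := A * x) (by positivity)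
    linarith
  have hL0 : 0 < ⌈A * x⌉₊ := Nat.ceil_pos.2 (by positivity)
  have h1 : 1 ≤ (16 * A) ^ d := one_le_pow₀ (by linarith)
  have hsplit : E / (2 * (16 * A) ^ d) * (1 / ((N ^ d : ℕ) : ℝ) + 1 / x ^ d) =
      (E / (16 * A) ^ d / (N ^ d : ℕ) + E / (16 * A) ^ d / x ^ d) / 2 := by
    field_simp
  have hleft : E / (16 * A) ^ d / (N ^ d : ℕ) ≤ E / (N ^ d : ℕ) :=
    div_le_div_of_nonneg_right (div_le_self hE0.le h1) hn'.le
  rw [hsplit]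
  rcases le_or_gt ⌈A * x⌉₊ N with hLN | hLN
  · have hb := hA N hN B hB ⌈A * x⌉₊ hL0 hLN (by
      rw [← hBx]
      calc A * (B ^ 2 * x ^ (2 * (k + 1) + d))
          ≤ A ^ (2 * (k + 1) + d) * (B ^ 2 * x ^ (2 * (k + 1) + d)) := by
            gcongr
            exact le_self_pow₀ hA1 (by omega)
        _ = B ^ 2 * (A * x) ^ (2 * (k + 1) + d) := by rw [mul_pow]; ring
        _ ≤ _ := by gcongr)
    have hright : E / (16 * A) ^ d / x ^ d ≤ E / (8 * (⌈A * x⌉₊ : ℝ)) ^ d := by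
      rw [div_div, ← mul_pow]
      refine div_le_div_of_nonneg_left hE0.le (by positivity) (pow_le_pow_left₀ (by positivity) ?_ d)
      linarith
    rcases le_total (E / (16 * A) ^ d / (N ^ d : ℕ)) (E / (16 * A) ^ d / x ^ d) with h | h
    · exact (ENNReal.ofReal_le_ofReal (by linarith)).trans hb
    · exact (ENNReal.ofReal_le_ofReal (by linarith)).trans hpar
  · refine (ENNReal.ofReal_le_ofReal ?_).trans hpar
    have hNx : (N : ℝ) ≤ 16 * A * x := by
      have : (N : ℝ) ≤ ⌈A * x⌉₊ := by exact_mod_cast hLN.le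
      nlinarith
    have hright : E / (16 * A) ^ d / x ^ d ≤ E / (N ^ d : ℕ) := by
      rw [div_div, ← mul_pow]
      refine div_le_div_of_nonneg_left hE0.le hn' ?_
      push_cast
      exact pow_le_pow_left₀ (by positivity) hNx d
    linarith

lemma card_filter_lt_le {N d : ℕ} (τ : ℕ) :
    (Finset.univ.filter (fun i : Fin d → Fin N => ∀ j, (i j : ℕ) < τ)).card ≤ τ ^ d := by
  have hc : (Fintype.piFinset fun _ : Fin d => Finset.range τ).card = τ ^ d := by simp
  rw [← hc]
  refine Finset.card_le_card_of_injOn (fun i j => (i j : ℕ)) (fun i hi => ?_) ?_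
  · simpa using hi
  · intro i _ i' _ h
    ext j
    exact congrFun h j

lemma add_pow_le_two_pow_mul {a b : ℝ} (ha : 0 ≤ a) (hb : 0 ≤ b) (d : ℕ) :
    (a + b) ^ d ≤ 2 ^ d * (a ^ d + b ^ d) := by
  rcases le_total a b with h | h
  · calc (a + b) ^ d ≤ (2 * b) ^ d := pow_le_pow_left₀ (by positivity) (by linarith) d
      _ = 2 ^ d * b ^ d := mul_pow _ _ _
      _ ≤ _ := by gcongr; exact le_add_of_nonneg_left (by positivity)
  · calc (a + b) ^ d ≤ (2 * a) ^ d := pow_le_pow_left₀ (by positivity) (by linarith) d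
      _ = 2 ^ d * a ^ d := mul_pow _ _ _
      _ ≤ _ := by gcongr; exact le_add_of_nonneg_right (by positivity)

/-- Risk bound for the projection onto low-frequency eigenvectors. -/
lemma exists_projEst_risk_le (k d N : ℕ) (σ : ℝ) (hN : 0 < N) (B x : ℝ)
    (hx : 1 ≤ x) (hBx : B ^ 2 * x ^ (2 * (k + 1) + d) = ((N ^ d : ℕ) : ℝ)) :
    ∃ τ : ℕ, τ ≤ N ∧
      ((τ ^ d : ℕ) : ℝ) ≤ (4 * (k + 1)) ^ d * (((N ^ d : ℕ) : ℝ) / x ^ d + 1) ∧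
      ∀ (ρ : Fin N → ℝ), Monotone ρ → ∀ u : Fin N → Fin N → ℝ,
        (∀ a b, ∑ x, u a x * u b x = if a = b then (1 : ℝ) else 0) →
        (∀ i, ((Dop N (k + 1))ᵀ * Dop N (k + 1)).mulVec (u i) = ρ i • u i) →
        ∀ v : (Fin d → Fin N) → (Fin d → Fin N) → ℝ,
        (∀ i i', ∑ x, v i x * v i' x = if i = i' then (1 : ℝ) else 0) →
        (∀ i, ((ktfMat N d (k + 1))ᵀ * ktfMat N d (k + 1)).mulVec (v i) =
          (∑ j, ρ (i j)) • v i) →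
        ∀ θ ∈ sobolevClass N d k B,
          riskE (projEst v (Finset.univ.filter fun i : Fin d → Fin N => ∀ j, (i j : ℕ) < τ)) θ σ ≤
            ENNReal.ofReal ((σ ^ 2 * (4 * (k + 1)) ^ d + 1) *
              (1 / ((N ^ d : ℕ) : ℝ) + 1 / x ^ d)) := by
  have hn : 0 < N ^ d := by positivity
  have hn' : (0 : ℝ) < (N ^ d : ℕ) := by exact_mod_cast hn
  have hx0 : 0 < x := by linarith
  set L := ⌊x⌋₊ with hLdef
  have hL : 0 < L := Nat.floor_pos.2 hx
  have hL' : (1 : ℝ) ≤ L := by exact_mod_cast hL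
  have hLx : (L : ℝ) ≤ x := Nat.floor_le hx0.le
  have hxL : x ≤ 2 * L := by
    have := Nat.lt_floor_add_one x
    linarith
  set R := N / L + 1 with hR
  have hNR : N ≤ L * R := (Nat.lt_mul_div_succ N hL).le
  have hRle : (R : ℝ) ≤ 2 * (N / x) + 1 := by
    rw [hR]
    push_cast
    have h1 : ((N / L : ℕ) : ℝ) ≤ N / L := Nat.cast_div_le
    have h2 : (N : ℝ) / L ≤ 2 * (N / x) := by
      rw [← mul_div_assoc, div_le_div_iff₀ (by linarith) hx0]
      nlinarith [(Nat.cast_nonneg N : (0 : ℝ) ≤ N)]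
    linarith
  have hτ : (((min N ((k + 1) * R)) ^ d : ℕ) : ℝ) ≤
      (4 * (k + 1)) ^ d * (((N ^ d : ℕ) : ℝ) / x ^ d + 1) := by
    have h1 : ((min N ((k + 1) * R) : ℕ) : ℝ) ≤ (k + 1) * (2 * (N / x + 1)) := by
      refine le_trans (Nat.cast_le.2 (min_le_right _ _)) ?_
      push_cast
      gcongr
      linarith
    rw [Nat.cast_pow]
    calc _ ≤ ((k + 1) * (2 * ((N : ℝ) / x + 1))) ^ d := pow_le_pow_left₀ (by positivity) h1 d
      _ = (2 * (k + 1)) ^ d * ((N : ℝ) / x + 1) ^ d := by rw [← mul_pow]; congr 1; ring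
      _ ≤ (2 * (k + 1)) ^ d * (2 ^ d * (((N : ℝ) / x) ^ d + 1 ^ d)) := by
        gcongr
        exact add_pow_le_two_pow_mul (by positivity) zero_le_one d
      _ = _ := by
        rw [← mul_assoc, ← mul_pow, div_pow, one_pow, Nat.cast_pow]; congr 2; ring
  refine ⟨min N ((k + 1) * R), min_le_left _ _, hτ, ?_⟩
  intro ρ hρ u hu heig v hv hve θ hθ
  rw [riskE_projEst v hv, inv_card_mul_ofReal hn]
  refine ENNReal.ofReal_le_ofReal ?_
  have hbias := bias_le hL hNR le_rfl u ρ hρ hu heig v hv hve θ hθ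
  have hb2 : (L : ℝ) ^ (2 * (k + 1)) * B ^ 2 ≤ (N ^ d : ℕ) / x ^ d := by
    rw [← hBx, pow_add, ← mul_assoc, mul_div_cancel_right₀ _ (by positivity), mul_comm]
    gcongr
  have hcard : ((Finset.univ.filter (fun i : Fin d → Fin N =>
      ∀ j, (i j : ℕ) < min N ((k + 1) * R))).card : ℝ) ≤
      (4 * (k + 1)) ^ d * (((N ^ d : ℕ) : ℝ) / x ^ d + 1) :=
    le_trans (by exact_mod_cast card_filter_lt_le _) hτ
  rw [div_le_iff₀ hn']
  have e : (σ ^ 2 * (4 * (k + 1)) ^ d + 1) * (1 / ((N ^ d : ℕ) : ℝ) + 1 / x ^ d) * (N ^ d : ℕ) =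
      σ ^ 2 * ((4 * (k + 1)) ^ d * (((N ^ d : ℕ) : ℝ) / x ^ d + 1)) +
        ((N ^ d : ℕ) : ℝ) / x ^ d + 1 := by
    field_simp
    ring
  rw [e]
  have := mul_le_mul_of_nonneg_left hcard (sq_nonneg σ)
  linarith

lemma measurable_projEst {ι : Type*} [Fintype ι] (v : ι → ι → ℝ) (Q : Finset ι) :
    Measurable (projEst v Q) := by
  refine measurable_pi_iff.2 fun x => ?_
  unfold projEst
  fun_prop

lemma minimaxRisk_upper (k d N : ℕ) (σ : ℝ) (hN : 0 < N) (B x : ℝ)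
    (hx : 1 ≤ x) (hBx : B ^ 2 * x ^ (2 * (k + 1) + d) = ((N ^ d : ℕ) : ℝ)) :
    minimaxRisk (sobolevClass N d k B) σ ≤
      ENNReal.ofReal ((σ ^ 2 * (4 * (k + 1)) ^ d + 1) *
        (1 / ((N ^ d : ℕ) : ℝ) + 1 / x ^ d)) := by
  obtain ⟨τ, -, -, h⟩ := exists_projEst_risk_le k d N σ hN B x hx hBx
  have hH : ((Dop N (k + 1))ᵀ * Dop N (k + 1)).IsHermitian := by
    simpa using isHermitian_conjTranspose_mul_self (Dop N (k + 1))
  obtain ⟨u, hu, heig⟩ := exists_orthonormal_eigenvectors _ hH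
    (hH.eigenvalues ∘ Tuple.sort hH.eigenvalues) (Tuple.sort hH.eigenvalues) fun _ => rfl
  refine (iInf_le _ ⟨projEst (tensorVec u)
    (Finset.univ.filter fun i : Fin d → Fin N => ∀ j, (i j : ℕ) < τ), measurable_projEst _ _⟩).trans
    (iSup₂_le fun θ hθ => ?_)
  exact h _ (Tuple.monotone_sort _) u hu heig _ (tensorVec_orthonormal u hu)
    (tensorVec_eigen u _ heig) θ hθ

/-- Theorem 6: minimax rates over discrete Sobolev classes.  With
`s = (k+1)/d`, there are `c, C > 0` depending only on `k, d, σ` such that for every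
`N > k+1` (`n = N^d ≥ 2`) and `0 < B_n ≤ √n`, the minimax risk over
`𝒲_{n,d}^{k+1}(B_n)` is between `c` and `C` times `1/n + min{(B_n²/n)^{1/(2s+1)}, 1}`;
the upper bound is attained by the projection estimator onto the eigenvectors of
`(D_{n,d}^{(k+1)})ᵀ D_{n,d}^{(k+1)}` indexed by `Q = {1,…,τ}^d` with
`τ^d ≲ (k+2)^d + (B_n² n^{2s})^{1/(2s+1)}`; and under the canonical scaling
`B_n = n^{1/2-s}` the minimax risk is of order `n^{-2s/(2s+1)}`. -/
theorem sobolev_minimax (k d : ℕ) (hd : 1 ≤ d) (σ : ℝ) (hσ : 0 < σ) :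
    ∃ c : ℝ, 0 < c ∧ ∃ C : ℝ, 0 < C ∧
      ∀ N : ℕ, k + 1 < N → 2 ≤ N ^ d →
      ∀ Bn : ℝ, 0 < Bn → Bn ≤ Real.sqrt ((N ^ d : ℕ) : ℝ) →
        (ENNReal.ofReal (c * sobolevRate k d N Bn) ≤
            minimaxRisk (sobolevClass N d k Bn) σ) ∧
        (minimaxRisk (sobolevClass N d k Bn) σ ≤
            ENNReal.ofReal (C * sobolevRate k d N Bn)) ∧
        (∀ (hH : ((Dop N (k + 1))ᵀ * Dop N (k + 1)).IsHermitian) (ρ : Fin N → ℝ),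
          Monotone ρ →
          (∃ σp : Equiv.Perm (Fin N), ∀ i, ρ i = hH.eigenvalues (σp i)) →
          ∀ v : (Fin d → Fin N) → (Fin d → Fin N) → ℝ,
            (∀ i i', ∑ x, v i x * v i' x = if i = i' then (1 : ℝ) else 0) →
            (∀ i, ((ktfMat N d (k + 1))ᵀ * ktfMat N d (k + 1)).mulVec (v i) =
              (∑ j, ρ (i j)) • v i) →
            ∃ τ : ℕ, τ ≤ N ∧
              ((τ ^ d : ℕ) : ℝ) ≤
                C * (((k + 2) ^ d : ℕ) +
                  (Bn ^ 2 * ((N ^ d : ℕ) : ℝ) ^ (2 * (((k : ℝ) + 1) / d))) ^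
                    ((1 : ℝ) / (2 * (((k : ℝ) + 1) / d) + 1))) ∧
              ∀ θ0 ∈ sobolevClass N d k Bn,
                riskE (fun y x =>
                    ∑ i ∈ Finset.univ.filter (fun i : Fin d → Fin N => ∀ j, (i j : ℕ) < τ),
                      (∑ x', v i x' * y x') * v i x) θ0 σ ≤
                  ENNReal.ofReal (C * sobolevRate k d N Bn)) ∧
        (Bn = ((N ^ d : ℕ) : ℝ) ^ ((1 : ℝ) / 2 - ((k : ℝ) + 1) / d) →
          ENNReal.ofReal (c * ((N ^ d : ℕ) : ℝ) ^
              (-(2 * (((k : ℝ) + 1) / d)) / (2 * (((k : ℝ) + 1) / d) + 1))) ≤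
            minimaxRisk (sobolevClass N d k Bn) σ ∧
          minimaxRisk (sobolevClass N d k Bn) σ ≤
            ENNReal.ofReal (C * ((N ^ d : ℕ) : ℝ) ^
              (-(2 * (((k : ℝ) + 1) / d)) / (2 * (((k : ℝ) + 1) / d) + 1)))) := by
  obtain ⟨c, hc, hlow⟩ := minimaxRisk_lower k d hd σ hσ
  set C1 : ℝ := (4 * (k + 1)) ^ d with hC1
  set C0 : ℝ := σ ^ 2 * C1 + 1 with hC0
  have hC10 : 0 < C1 := by positivity
  have hC00 : 0 < C0 := by positivity
  refine ⟨c, hc, 2 * C0 + C1, by positivity, fun N hkN hn2 B hB hBn => ?_⟩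
  have hN : 0 < N := by omega
  have hn : 0 < N ^ d := by omega
  have hn' : (0 : ℝ) < (N ^ d : ℕ) := by exact_mod_cast hn
  obtain ⟨x, hx, hBx, hrate, hdim, hcan⟩ := exists_bandwidth k d N hd hn B hB hBn
  have hx0 : 0 < x := by linarith
  have hr0 : 0 ≤ 1 / ((N ^ d : ℕ) : ℝ) + 1 / x ^ d := by positivity
  have hC : C0 * (1 / ((N ^ d : ℕ) : ℝ) + 1 / x ^ d) ≤
      (2 * C0 + C1) * (1 / ((N ^ d : ℕ) : ℝ) + 1 / x ^ d) :=
    mul_le_mul_of_nonneg_right (by linarith) hr0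
  have hl := hlow N hN B x hB hx hBx
  have hu := minimaxRisk_upper k d N σ hN B x hx hBx
  rw [hrate, hdim]
  refine ⟨hl, hu.trans (ENNReal.ofReal_le_ofReal hC), ?_, fun hBs => ?_⟩
  · rintro hH ρ hρ ⟨π, hπ⟩ v hv hve
    obtain ⟨τ, hτN, hτ, h⟩ := exists_projEst_risk_le k d N σ hN B x hx hBx
    obtain ⟨u, hu', heig⟩ := exists_orthonormal_eigenvectors _ hH ρ π hπ
    refine ⟨τ, hτN, hτ.trans ?_, fun θ hθ =>
      (h ρ hρ u hu' heig v hv hve θ hθ).trans (ENNReal.ofReal_le_ofReal hC)⟩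
    have h1 : (1 : ℝ) ≤ ((k + 2) ^ d : ℕ) := by exact_mod_cast Nat.one_le_pow _ _ (by omega)
    have h2 : 0 ≤ ((N ^ d : ℕ) : ℝ) / x ^ d := by positivity
    exact mul_le_mul (by linarith) (by linarith) (by positivity) (by positivity)
  · have hle : 1 / ((N ^ d : ℕ) : ℝ) ≤ 1 / x ^ d := by
      rw [← hcan hBs, one_div, ← Real.rpow_neg_one]
      refine Real.rpow_le_rpow_of_exponent_le (by exact_mod_cast hn) ?_
      have hs : 0 < ((k : ℝ) + 1) / d := by
        have : (0 : ℝ) < d := by exact_mod_cast hd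
        positivity
      rw [le_div_iff₀ (by positivity)]
      linarith
    have hi : 0 < 1 / x ^ d := by positivity
    have hj : 0 < 1 / ((N ^ d : ℕ) : ℝ) := by positivity
    rw [hcan hBs]
    refine ⟨(ENNReal.ofReal_le_ofReal ?_).trans hl, hu.trans (ENNReal.ofReal_le_ofReal ?_)⟩
    · exact mul_le_mul_of_nonneg_left (by linarith) hc.le
    · nlinarith
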